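/- Existence of a non-real magic angle for the Bistritzer–MacDonald potential: For the chiral model with the Bistritzer–MacDonald potential U_BM, there exists a magic parameter α ∈ ℂ with α ∉ ℝ. -/

import Mathlib

noncomputable section

open Complex MeasureTheory

namespace TBG

/-- `ω = exp(2πi/3)`. -/
def ω : ℂ := Complex.exp (2 * Real.pi * Complex.I / 3)

/-- The moiré lattice `Λ = ℤω + ℤ ⊂ ℂ`. -/
def Λ : Set ℂ := {z : ℂ | ∃ m n : ℤ, z = m * ω + n}

/-- The dual lattice `Λ* = (4πi/√3)·Λ`. -/
def Λdual : Set ℂ := {p : ℂ | ∃ m n : ℤ, p = 4 * Real.pi * Complex.I / Real.sqrt 3 * (m * ω + n)}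

/-- The high symmetry point `K = 4π/3`. -/
def K : ℂ := 4 * Real.pi / 3

/-- `⟨z,w⟩ = Re (z · conj w)`. -/
def pair (z w : ℂ) : ℝ := (z * (starRingEnd ℂ) w).re

/-- `2 D_z̄ f = (1/i)(∂_x f + i ∂_y f)`. -/
def Dbar (f : ℂ → ℂ) (z : ℂ) : ℂ :=
  1 / Complex.I * (fderiv ℝ f z 1 + Complex.I * fderiv ℝ f z Complex.I)

/-- A tunnelling potential: smooth, with the translational and rotational symmetries. -/
def IsTunnelling (U : ℂ → ℂ) : Prop :=
  ContDiff ℝ (⊤ : ℕ∞) U ∧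
    (∀ γ ∈ Λ, ∀ z : ℂ, U (z + γ) = Complex.exp (Complex.I * (pair γ K : ℂ)) * U z) ∧
    ∀ z : ℂ, U (ω * z) = ω * U z

/-- Membership in `ker_{L²₀}(D(α)+k)` for the chiral model with tunnelling
potentials `U₊ = Up`, `U₋ = Um`: smooth solutions of `(D(α)+k)u = 0` with the
Floquet boundary conditions. -/
def InKer (Up Um : ℂ → ℂ) (α k : ℂ) (u : ℂ → ℂ × ℂ) : Prop :=
  ContDiff ℝ (⊤ : ℕ∞) u ∧
    (∀ z : ℂ, Dbar (fun w => (u w).1) z + k * (u z).1 + α * Up z * (u z).2 = 0) ∧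
    (∀ z : ℂ, Dbar (fun w => (u w).2) z + k * (u z).2 + α * Um z * (u z).1 = 0) ∧
    (∀ γ ∈ Λ, ∀ z : ℂ, (u (z + γ)).1 = Complex.exp (-Complex.I * (pair γ K : ℂ)) * (u z).1) ∧
    (∀ γ ∈ Λ, ∀ z : ℂ, (u (z + γ)).2 = Complex.exp (Complex.I * (pair γ K : ℂ)) * (u z).2)

/-- `Ker(α,k)` as a set of functions. -/
def kerSet (Up Um : ℂ → ℂ) (α k : ℂ) : Set (ℂ → ℂ × ℂ) := {u | InKer Up Um α k u}

/-- `dim_ℂ Ker(α,k)` (the set `Ker(α,k)` is a linear subspace, so the finrank of its span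
is its dimension). -/
def kerDim (Up Um : ℂ → ℂ) (α k : ℂ) : ℕ :=
  Module.finrank ℂ ↥(Submodule.span ℂ (kerSet Up Um α k))

/-- `Ker_p(α) = {u ∈ Ker(α,0) : u(ωz) = ω^(−p)·u(z)}`. -/
def kerPSet (Up Um : ℂ → ℂ) (α : ℂ) (p : ℕ) : Set (ℂ → ℂ × ℂ) :=
  {u | u ∈ kerSet Up Um α 0 ∧ ∀ z : ℂ, u (ω * z) = (ω ^ (-(p : ℤ))) • u z}

/-- `dim_ℂ Ker_p(α)`. -/
def kerPDim (Up Um : ℂ → ℂ) (α : ℂ) (p : ℕ) : ℕ :=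
  Module.finrank ℂ ↥(Submodule.span ℂ (kerPSet Up Um α p))

/-- `α` is magic: the flat band condition `Ker(α,k) ≠ {0}` for every `k`. -/
def IsMagic (Up Um : ℂ → ℂ) (α : ℂ) : Prop :=
  ∀ k : ℂ, ∃ u ∈ kerSet Up Um α k, u ≠ 0


/-- The (rescaled) Bistritzer–MacDonald potential
`U_BM(z) = −(4π/3)·i·Σ_{ℓ=0}^{2} ω^ℓ·exp((4π/3)·i·⟨z,ω^ℓ⟩)`. -/
def UBM (z : ℂ) : ℂ :=
  -(4 * Real.pi / 3) * Complex.I *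
    ∑ l ∈ Finset.range 3, ω ^ l * Complex.exp (4 * Real.pi / 3 * Complex.I * (pair z (ω ^ l) : ℂ))

lemma ω_re : ω.re = -1 / 2 := by
  have h : (2 * Real.pi * I / 3 : ℂ) = ((2 * Real.pi / 3 : ℝ) : ℂ) * I := by push_cast; ring
  have h' : (2 * Real.pi / 3 : ℝ) = Real.pi - Real.pi / 3 := by ring
  rw [ω, h, exp_ofReal_mul_I_re, h', Real.cos_pi_sub, Real.cos_pi_div_three]
  norm_num

lemma ω_im : ω.im = Real.sqrt 3 / 2 := by
  have h : (2 * Real.pi * I / 3 : ℂ) = ((2 * Real.pi / 3 : ℝ) : ℂ) * I := by push_cast; ring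
  have h' : (2 * Real.pi / 3 : ℝ) = Real.pi - Real.pi / 3 := by ring
  rw [ω, h, exp_ofReal_mul_I_im, h', Real.sin_pi_sub, Real.sin_pi_div_three]

lemma ω_sq : ω ^ 2 = -1 - ω := by
  have h3 : Real.sqrt 3 * Real.sqrt 3 = 3 := Real.mul_self_sqrt (by norm_num)
  apply Complex.ext
  · simp [pow_two, ω_re, ω_im]; nlinarith
  · simp [pow_two, ω_re, ω_im]; ring

lemma ω_cube : ω ^ 3 = 1 := by
  linear_combination (ω - 1) * ω_sq

lemma norm_ω : ‖ω‖ = 1 := by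
  have : ‖ω‖ ^ 3 = 1 := by rw [← norm_pow, ω_cube, norm_one]
  exact (pow_eq_one_iff_of_nonneg (norm_nonneg _) (by norm_num)).mp this

/-- The Eisenstein integer `a + bω`. -/
def ev (x : ℤ × ℤ) : ℂ := x.1 + x.2 * ω

/-- The norm form of the Eisenstein integers. -/
def enorm2 (x : ℤ × ℤ) : ℤ := x.1 ^ 2 - x.1 * x.2 + x.2 ^ 2

lemma ev_re (x : ℤ × ℤ) : (ev x).re = x.1 - x.2 / 2 := by
  simp [ev, ω_re, ω_im]; ring

lemma ev_im (x : ℤ × ℤ) : (ev x).im = x.2 * (Real.sqrt 3 / 2) := by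
  simp [ev, ω_re, ω_im]

lemma norm_ev_sq (x : ℤ × ℤ) : ‖ev x‖ ^ 2 = enorm2 x := by
  have h3 : Real.sqrt 3 ^ 2 = 3 := Real.sq_sqrt (by norm_num)
  rw [← normSq_eq_norm_sq, normSq_apply, ev_re, ev_im, enorm2]
  push_cast
  linear_combination (x.2 : ℝ) ^ 2 / 4 * h3

/-- The momentum (in units of `K`) of the first component with index `s`. -/
def site (s : ℤ × ℤ) : ℤ × ℤ := (s.1 - 2 * s.2 - 1, 2 * s.1 - s.2)

/-- The momenta of the first component, as complex numbers. -/
def mom (s : ℤ × ℤ) : ℂ := ev (site s)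

/-- The index offsets realising the three hoppings. -/
def offset : Fin 3 → ℤ × ℤ := ![(-1, -2), (0, -1), (-1, -1)]

lemma mom_offset_sub (l : Fin 3) (s : ℤ × ℤ) : mom (offset l - s) = ω ^ (l : ℕ) - mom s := by
  have := ω_sq
  fin_cases l <;> simp [mom, ev, site, offset, ω_sq] <;> ring

lemma mom_add (s r : ℤ × ℤ) : mom (s + r) = mom s + (mom r + 1) := by
  simp [mom, ev, site]; ring

lemma mom_re (s : ℤ × ℤ) : (mom s).re = -1 - 3 / 2 * s.2 := by
  rw [mom, ev_re]; simp [site]; ring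

lemma mom_im (s : ℤ × ℤ) : (mom s).im = (2 * s.1 - s.2) * (Real.sqrt 3 / 2) := by
  rw [mom, ev_im]; simp [site]

lemma mom_injective : Function.Injective mom := by
  intro s r h
  have h1 := congrArg Complex.re h
  have h2 := congrArg Complex.im h
  have h3 : Real.sqrt 3 / 2 ≠ 0 := by positivity
  rw [mom_re, mom_re] at h1
  rw [mom_im, mom_im] at h2
  have h4 := mul_right_cancel₀ h3 h2
  have e2 : (s.2 : ℝ) = r.2 := by linarith
  have e1 : (s.1 : ℝ) = r.1 := by rw [e2] at h4; linarith
  exact Prod.ext (by exact_mod_cast e1) (by exact_mod_cast e2)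

/-- Faster than polynomial decay of a family indexed by the momenta. -/
def RapidDecay (A : ℤ × ℤ → ℂ) : Prop := ∀ n : ℕ, ∃ C : ℝ, ∀ s, ‖A s‖ * (1 + ‖mom s‖) ^ n ≤ C

lemma summable_one_div_mom : Summable fun s : ℤ × ℤ => ((1 + ‖mom s‖) ^ 4)⁻¹ := by
  have h1 : Summable fun n : ℤ => (1 + (n : ℝ) ^ 2)⁻¹ := by
    have h : Summable fun n : ℤ => 1 / (n : ℝ) ^ 2 := Real.summable_one_div_int_pow.mpr (by norm_num)
    refine Summable.of_norm_bounded_eventually h ?_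
    have : ({0} : Set ℤ)ᶜ ∈ Filter.cofinite := (Set.finite_singleton 0).compl_mem_cofinite
    filter_upwards [this] with n hn
    have hn0 : (n : ℝ) ≠ 0 := by exact_mod_cast hn
    rw [Real.norm_of_nonneg (by positivity), one_div]
    exact inv_anti₀ (by positivity) (by linarith)
  have h2 := h1.mul_of_nonneg h1 (fun n => by positivity) (fun n => by positivity)
  refine Summable.of_nonneg_of_le (fun s => by positivity) (fun s => ?_) (h2.mul_left 16)
  have hx : |(mom s).re| ≤ ‖mom s‖ := abs_re_le_norm _
  have hy : |(mom s).im| ≤ ‖mom s‖ := abs_im_le_norm _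
  set N := ‖mom s‖
  have hN : 0 ≤ N := norm_nonneg _
  have h3 : Real.sqrt 3 ^ 2 = 3 := Real.sq_sqrt (by norm_num)
  have hN2 : N ^ 2 = (1 + 3 / 2 * s.2) ^ 2 + ((2 * s.1 - s.2) ^ 2 : ℝ) * (3 / 4) := by
    rw [← normSq_eq_norm_sq, normSq_apply, mom_re, mom_im]
    linear_combination (2 * s.1 - s.2 : ℝ) ^ 2 / 4 * h3
  have hb : (1 + (s.1 : ℝ) ^ 2) ≤ 4 * (1 + N) ^ 2 := by
    rw [mom_re] at hx
    nlinarith [sq_nonneg ((s.1 : ℝ) - 2 * s.2 - 1), sq_nonneg ((s.1 : ℝ) + s.2), sq_nonneg (s.2 : ℝ),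
      abs_le.mp hx]
  have hc : (1 + (s.2 : ℝ) ^ 2) ≤ 4 * (1 + N) ^ 2 := by
    rw [mom_re] at hx
    nlinarith [abs_le.mp hx]
  have hbc : (1 + (s.1 : ℝ) ^ 2) * (1 + (s.2 : ℝ) ^ 2) ≤ 16 * (1 + N) ^ 4 := by
    calc _ ≤ (4 * (1 + N) ^ 2) * (4 * (1 + N) ^ 2) := by gcongr
      _ = _ := by ring
  rw [← mul_inv, ← div_eq_mul_inv, inv_eq_one_div, div_le_div_iff₀ (by positivity) (by positivity)]
  linarith

lemma RapidDecay.summable_pow {A : ℤ × ℤ → ℂ} (hA : RapidDecay A) (n : ℕ) :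
    Summable fun s => ‖A s‖ * (1 + ‖mom s‖) ^ n := by
  obtain ⟨C, hC⟩ := hA (n + 4)
  refine Summable.of_nonneg_of_le (fun s => by positivity) (fun s => ?_)
    (summable_one_div_mom.mul_left C)
  rw [← div_eq_mul_inv, le_div_iff₀ (by positivity), mul_assoc, ← pow_add]
  exact hC s

lemma RapidDecay.summable_norm {A : ℤ × ℤ → ℂ} (hA : RapidDecay A) : Summable fun s => ‖A s‖ := by
  simpa using hA.summable_pow 0

/-- The plane wave of momentum `K p`. -/
def wave (p z : ℂ) : ℂ := cexp (I * ((4 * Real.pi / 3 * pair z p : ℝ) : ℂ))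

lemma pair_eq (z w : ℂ) : pair z w = z.re * w.re + z.im * w.im := by
  simp [pair]

lemma norm_wave (p z : ℂ) : ‖wave p z‖ = 1 := by
  rw [wave, mul_comm, norm_exp_ofReal_mul_I]

lemma wave_add (p q z : ℂ) : wave (p + q) z = wave p z * wave q z := by
  rw [wave, wave, wave, ← Complex.exp_add]
  congr 1
  simp only [pair_eq, add_re, add_im]
  push_cast
  ring

lemma wave_add_right (p z w : ℂ) : wave p (z + w) = wave p z * wave p w := by
  rw [wave, wave, wave, ← Complex.exp_add]
  congr 1
  simp only [pair_eq, add_re, add_im]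
  push_cast
  ring

/-- The real part as a real-linear map to the complex numbers. -/
def reL : ℂ →L[ℝ] ℂ := ofRealCLM.comp reCLM

/-- The imaginary part as a real-linear map to the complex numbers. -/
def imL : ℂ →L[ℝ] ℂ := ofRealCLM.comp imCLM

@[simp] lemma reL_apply (z : ℂ) : reL z = z.re := rfl

@[simp] lemma imL_apply (z : ℂ) : imL z = z.im := rfl

lemma norm_reL_le : ‖reL‖ ≤ 1 :=
  ContinuousLinearMap.opNorm_le_bound _ zero_le_one fun z => by
    simpa [norm_real] using abs_re_le_norm z

lemma norm_imL_le : ‖imL‖ ≤ 1 :=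
  ContinuousLinearMap.opNorm_le_bound _ zero_le_one fun z => by
    simpa [norm_real] using abs_im_le_norm z

/-- The Fourier series with coefficients `A` at the momenta `ε * mom s`. -/
def fseries (ε : ℝ) (A : ℤ × ℤ → ℂ) (z : ℂ) : ℂ := ∑' s, A s * wave (ε * mom s) z

lemma RapidDecay.summable_mul_wave {A : ℤ × ℤ → ℂ} (hA : RapidDecay A) (ε : ℝ) (z : ℂ) :
    Summable fun s => A s * wave (ε * mom s) z :=
  Summable.of_norm (by simpa [norm_wave] using hA.summable_norm)

lemma RapidDecay.mul_of_le {A f : ℤ × ℤ → ℂ} (hA : RapidDecay A) (D : ℝ)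
    (hf : ∀ s, ‖f s‖ ≤ D * (1 + ‖mom s‖)) : RapidDecay fun s => A s * f s := by
  intro n
  obtain ⟨C, hC⟩ := hA (n + 1)
  have hD : 0 ≤ D := by
    have h := (norm_nonneg _).trans (hf 0)
    exact nonneg_of_mul_nonneg_left h (by positivity)
  refine ⟨D * C, fun s => ?_⟩
  rw [norm_mul]
  calc ‖A s‖ * ‖f s‖ * (1 + ‖mom s‖) ^ n
      ≤ ‖A s‖ * (D * (1 + ‖mom s‖)) * (1 + ‖mom s‖) ^ n := by gcongr; exact hf s
    _ = D * (‖A s‖ * (1 + ‖mom s‖) ^ (n + 1)) := by ring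
    _ ≤ D * C := by gcongr; exact hC s

lemma RapidDecay.mul_re {A : ℤ × ℤ → ℂ} (hA : RapidDecay A) (ε : ℝ) :
    RapidDecay fun s => A s * (I * (4 * Real.pi / 3) * (ε * mom s).re) := by
  refine hA.mul_of_le (4 * Real.pi / 3 * |ε|) fun s => ?_
  have := abs_re_le_norm (mom s)
  have h0 := Real.pi_pos
  simp [abs_of_pos h0, mul_assoc]
  gcongr
  linarith

lemma RapidDecay.mul_im {A : ℤ × ℤ → ℂ} (hA : RapidDecay A) (ε : ℝ) :
    RapidDecay fun s => A s * (I * (4 * Real.pi / 3) * (ε * mom s).im) := by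
  refine hA.mul_of_le (4 * Real.pi / 3 * |ε|) fun s => ?_
  have := abs_im_le_norm (mom s)
  have h0 := Real.pi_pos
  simp [abs_of_pos h0, mul_assoc]
  gcongr
  linarith

lemma hasFDerivAt_wave (p z : ℂ) :
    HasFDerivAt (wave p) ((wave p z * (I * (4 * Real.pi / 3) * p.re)) • reL
      + (wave p z * (I * (4 * Real.pi / 3) * p.im)) • imL) z := by
  have h : HasFDerivAt (fun z : ℂ => I * ((4 * Real.pi / 3 * pair z p : ℝ) : ℂ))
      ((I * (4 * Real.pi / 3) * p.re) • reL + (I * (4 * Real.pi / 3) * p.im) • imL) z := by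
    have e : (fun z : ℂ => I * ((4 * Real.pi / 3 * pair z p : ℝ) : ℂ)) =
        ((I * (4 * Real.pi / 3) * p.re) • reL + (I * (4 * Real.pi / 3) * p.im) • imL
          : ℂ →L[ℝ] ℂ) := by
      funext z
      simp [pair_eq]
      ring
    rw [e]
    exact ContinuousLinearMap.hasFDerivAt _
  have h2 := h.cexp
  refine h2.congr_fderiv ?_
  rw [smul_add, smul_smul, smul_smul]
  rfl

lemma hasFDerivAt_fseries {A : ℤ × ℤ → ℂ} (hA : RapidDecay A) (ε : ℝ) (z : ℂ) :
    HasFDerivAt (fseries ε A)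
      ((fseries ε (fun s => A s * (I * (4 * Real.pi / 3) * (ε * mom s).re)) z) • reL +
        (fseries ε (fun s => A s * (I * (4 * Real.pi / 3) * (ε * mom s).im)) z) • imL) z := by
  have hre := hA.mul_re ε
  have him := hA.mul_im ε
  have key := hasFDerivAt_tsum (𝕜 := ℝ) (f := fun s z => A s * wave (ε * mom s) z)
    (f' := fun s z => (A s * (I * (4 * Real.pi / 3) * (ε * mom s).re) * wave (ε * mom s) z) • reL +
      (A s * (I * (4 * Real.pi / 3) * (ε * mom s).im) * wave (ε * mom s) z) • imL)
    (hre.summable_norm.add him.summable_norm) (fun s z => ?_) (fun s z => ?_)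
    (hA.summable_mul_wave ε 0) z
  · refine key.congr_fderiv ?_
    rw [(Summable.tsum_add ((hre.summable_mul_wave ε z).smul_const reL)
      ((him.summable_mul_wave ε z).smul_const imL)),
      (hre.summable_mul_wave ε z).tsum_smul_const, (him.summable_mul_wave ε z).tsum_smul_const]
    rfl
  · refine ((hasFDerivAt_wave (ε * mom s) z).const_mul (A s)).congr_fderiv ?_
    rw [smul_add, smul_smul, smul_smul]
    congr 2 <;> ring
  · refine (norm_add_le _ _).trans (add_le_add ?_ ?_)
    · rw [norm_smul, norm_mul, norm_wave, mul_one]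
      exact mul_le_of_le_one_right (norm_nonneg _) norm_reL_le
    · rw [norm_smul, norm_mul, norm_wave, mul_one]
      exact mul_le_of_le_one_right (norm_nonneg _) norm_imL_le

lemma contDiff_fseries (ε : ℝ) (n : ℕ) :
    ∀ {A : ℤ × ℤ → ℂ}, RapidDecay A → ContDiff ℝ n (fseries ε A) := by
  induction n with
  | zero =>
    intro A hA
    exact contDiff_zero.mpr (continuous_iff_continuousAt.mpr fun z =>
      (hasFDerivAt_fseries hA ε z).continuousAt)
  | succ n ih =>
    intro A hA
    have hre := hA.mul_re ε
    have him := hA.mul_im ε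
    push_cast
    rw [contDiff_succ_iff_fderiv]
    refine ⟨fun z => (hasFDerivAt_fseries hA ε z).differentiableAt, by simp, ?_⟩
    have e : fderiv ℝ (fseries ε A) = fun z => _ :=
      funext fun z => (hasFDerivAt_fseries hA ε z).fderiv
    rw [e]
    exact ((ih hre).smul contDiff_const).add ((ih him).smul contDiff_const)

lemma Dbar_fseries {A : ℤ × ℤ → ℂ} (hA : RapidDecay A) (ε : ℝ) (z : ℂ) :
    Dbar (fseries ε A) z = fseries ε (fun s => A s * (4 * Real.pi / 3 * (ε * mom s))) z := by
  have hre := hA.mul_re ε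
  have him := hA.mul_im ε
  rw [Dbar, (hasFDerivAt_fseries hA ε z).fderiv]
  simp only [_root_.add_apply, _root_.smul_apply, reL_apply, imL_apply,
    one_re, one_im, I_re, I_im, ofReal_one, ofReal_zero, smul_eq_mul, mul_one, mul_zero, add_zero,
    zero_add]
  rw [fseries, fseries, fseries, ← tsum_mul_left, ← Summable.tsum_add (hre.summable_mul_wave ε z)
    ((him.summable_mul_wave ε z).mul_left I), ← tsum_mul_left]
  refine tsum_congr fun s => ?_
  have h := re_add_im (ε * mom s)
  have hI : I ≠ 0 := I_ne_zero
  field_simp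
  linear_combination (A s * wave (ε * mom s) z) * h

lemma UBM_mul_fseries {B : ℤ × ℤ → ℂ} (hB : RapidDecay B) (ε : ℝ) (z : ℂ) :
    UBM (ε * z) * fseries (-ε) B z =
      fseries ε (fun s => -(4 * Real.pi / 3) * I * ∑ l : Fin 3, ω ^ (l : ℕ) * B (offset l - s)) z := by
  have hU : UBM (ε * z) = -(4 * Real.pi / 3) * I *
      ∑ l : Fin 3, ω ^ (l : ℕ) * wave (ε * ω ^ (l : ℕ)) z := by
    rw [UBM, Finset.sum_range]
    congr 1
    refine Finset.sum_congr rfl fun l _ => ?_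
    rw [wave]
    congr 2
    simp only [pair_eq, re_ofReal_mul, im_ofReal_mul]
    push_cast
    ring
  have hl (l : Fin 3) : HasSum (fun s => ω ^ (l : ℕ) * B (offset l - s) * wave (ε * mom s) z)
      (ω ^ (l : ℕ) * wave (ε * ω ^ (l : ℕ)) z * fseries (-ε) B z) := by
    have h := ((hB.summable_mul_wave (-ε) z).hasSum.mul_left
      (ω ^ (l : ℕ) * wave (ε * ω ^ (l : ℕ)) z))
    rw [← (Equiv.subLeft (offset l)).hasSum_iff] at h
    have e : ((fun s => ω ^ (l : ℕ) * wave (ε * ω ^ (l : ℕ)) z * (B s * wave ((-ε : ℝ) * mom s) z)) ∘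
        Equiv.subLeft (offset l)) =
        fun s => ω ^ (l : ℕ) * B (offset l - s) * wave (ε * mom s) z := by
      funext s
      have hw : wave (ε * mom s) z =
          wave (ε * ω ^ (l : ℕ)) z * wave ((-ε : ℝ) * mom (offset l - s)) z := by
        rw [← wave_add, mom_offset_sub]
        congr 1
        push_cast
        ring
      simp only [Function.comp_apply, Equiv.subLeft_apply]
      rw [hw]
      ring
    rw [e] at h
    exact h
  have hs := (hasSum_sum fun l (_ : l ∈ Finset.univ) => hl l).mul_left (-(4 * Real.pi / 3) * I)
  rw [hU, mul_assoc, Finset.sum_mul]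
  refine Eq.trans ?_ (hs.tsum_eq.symm.trans ?_)
  · rfl
  rw [fseries]
  refine tsum_congr fun s => ?_
  rw [Finset.mul_sum, Finset.mul_sum, Finset.sum_mul]
  exact Finset.sum_congr rfl fun l _ => by ring

lemma fseries_eq (ε : ℝ) (A : ℤ × ℤ → ℂ) (z : ℂ) : fseries ε A z = fseries 1 A (ε * z) := by
  refine tsum_congr fun s => ?_
  rw [wave, wave]
  congr 4
  simp only [pair_eq, re_ofReal_mul, im_ofReal_mul]
  ring

lemma fseries_add {A B : ℤ × ℤ → ℂ} (hA : RapidDecay A) (hB : RapidDecay B) (ε : ℝ) (z : ℂ) :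
    fseries ε (fun s => A s + B s) z = fseries ε A z + fseries ε B z := by
  rw [fseries, fseries, fseries, ← (hA.summable_mul_wave ε z).tsum_add (hB.summable_mul_wave ε z)]
  simp only [add_mul]

lemma fseries_const_mul (c : ℂ) (A : ℤ × ℤ → ℂ) (ε : ℝ) (z : ℂ) :
    fseries ε (fun s => c * A s) z = c * fseries ε A z := by
  rw [fseries, fseries, ← tsum_mul_left]
  simp only [mul_assoc]

lemma integral_exp_int (n : ℤ) :
    ∫ x in (0 : ℝ)..1, cexp (2 * Real.pi * I * n * x) = if n = 0 then 1 else 0 := by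
  split_ifs with h
  · simp [h]
  · have hn : (2 * Real.pi * I * n : ℂ) ≠ 0 := by simp [h, Real.pi_ne_zero]
    rw [integral_exp_mul_complex hn]
    have : cexp (2 * Real.pi * I * n) = 1 := by
      rw [mul_comm]; exact exp_int_mul_two_pi_mul_I n
    simp [this]

lemma eq_zero_of_fourier_eq_zero {c : ℤ → ℂ} (hc : Summable fun m => ‖c m‖)
    (h : ∀ x : ℝ, ∑' m, c m * cexp (2 * Real.pi * I * m * x) = 0) (m₀ : ℤ) : c m₀ = 0 := by
  have hn (m : ℤ) (x : ℝ) : ‖cexp (2 * Real.pi * I * m * x)‖ = 1 := by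
    have : (2 * Real.pi * I * m * x : ℂ) = ((2 * Real.pi * m * x : ℝ) : ℂ) * I := by
      push_cast; ring
    rw [this, norm_exp_ofReal_mul_I]
  have hs (x : ℝ) : Summable fun m => c m * cexp (2 * Real.pi * I * m * x) :=
    Summable.of_norm (by simpa [hn] using hc)
  have key := intervalIntegral.hasSum_integral_of_dominated_convergence (a := 0) (b := 1)
    (μ := volume) (F := fun m (x : ℝ) => c m * cexp (2 * Real.pi * I * (m - m₀ : ℤ) * x))
    (f := fun _ => 0) (fun m _ => ‖c m‖) (fun m => by fun_prop)
    (fun m => Filter.Eventually.of_forall fun x _ => by rw [norm_mul, hn, mul_one])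
    (Filter.Eventually.of_forall fun x _ => hc) (by simp)
    (Filter.Eventually.of_forall fun x _ => by
      have := (hs x).hasSum.mul_right (cexp (2 * Real.pi * I * (-m₀ : ℤ) * x))
      rw [h, zero_mul] at this
      have e (m : ℤ) : c m * cexp (2 * Real.pi * I * (m - m₀ : ℤ) * x) =
          c m * cexp (2 * Real.pi * I * m * x) * cexp (2 * Real.pi * I * (-m₀ : ℤ) * x) := by
        rw [mul_assoc (c m), ← Complex.exp_add]
        congr 2
        push_cast
        ring
      simp only [e]
      exact this)
  simp only [intervalIntegral.integral_const_mul, integral_exp_int, sub_eq_zero,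
    intervalIntegral.integral_zero] at key
  have h2 := hasSum_ite_eq m₀ (c m₀)
  have h3 : (fun m => c m * (if m = m₀ then 1 else 0 : ℂ)) = fun m => if m = m₀ then c m₀ else 0 := by
    funext m
    split_ifs with hm <;> simp [hm]
  rw [h3] at key
  exact h2.unique key

lemma eq_zero_of_fseries_eq_zero {A : ℤ × ℤ → ℂ} (hA : RapidDecay A) {ε : ℝ} (hε : ε ≠ 0)
    (h : ∀ z, fseries ε A z = 0) (s : ℤ × ℤ) : A s = 0 := by
  have h1 (z : ℂ) : fseries 1 A z = 0 := by
    have := h ((ε⁻¹ : ℝ) * z)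
    rw [fseries_eq, ← mul_assoc, ← ofReal_mul, mul_inv_cancel₀ hε, ofReal_one, one_mul] at this
    exact this
  have hs3 : Real.sqrt 3 ^ 2 = 3 := Real.sq_sqrt (by norm_num)
  have hw (s : ℤ × ℤ) (x y : ℝ) : wave ((1 : ℝ) * mom s) (⟨-y - x / 2, Real.sqrt 3 / 2 * x⟩ : ℂ) =
      cexp (2 * Real.pi * I * s.2 * y) * cexp (2 * Real.pi * I * s.1 * x) *
        wave (-1) (⟨-y - x / 2, Real.sqrt 3 / 2 * x⟩ : ℂ) := by
    rw [ofReal_one, one_mul, wave, wave, ← Complex.exp_add, ← Complex.exp_add]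
    congr 1
    have : (4 * Real.pi / 3 * pair (⟨-y - x / 2, Real.sqrt 3 / 2 * x⟩ : ℂ) (mom s) : ℝ) =
        2 * Real.pi * s.2 * y + 2 * Real.pi * s.1 * x +
          4 * Real.pi / 3 * pair (⟨-y - x / 2, Real.sqrt 3 / 2 * x⟩ : ℂ) (-1) := by
      simp only [pair_eq, mom_re, mom_im, neg_re, neg_im, one_re, one_im]
      linear_combination (Real.pi / 3 * x * (2 * s.1 - s.2)) * hs3
    rw [this]
    push_cast
    ring
  have hn (m : ℤ) (x : ℝ) : ‖cexp (2 * Real.pi * I * m * x)‖ = 1 := by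
    have : (2 * Real.pi * I * m * x : ℂ) = ((2 * Real.pi * m * x : ℝ) : ℂ) * I := by
      push_cast; ring
    rw [this, norm_exp_ofReal_mul_I]
  have hsum : Summable fun s => ‖A s‖ := hA.summable_norm
  have hsy (y : ℝ) : Summable fun s : ℤ × ℤ => ‖A s * cexp (2 * Real.pi * I * s.2 * y)‖ := by
    simpa [hn] using hsum
  have step (y : ℝ) (m : ℤ) : ∑' n : ℤ, A (m, n) * cexp (2 * Real.pi * I * n * y) = 0 := by
    refine eq_zero_of_fourier_eq_zero
      (c := fun m => ∑' n : ℤ, A (m, n) * cexp (2 * Real.pi * I * n * y)) ?_ (fun x => ?_) m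
    · refine Summable.of_nonneg_of_le (fun _ => norm_nonneg _) (fun m => ?_) (hsy y).prod
      exact norm_tsum_le_tsum_norm ((hsy y).prod_factor m)
    · have h2 : Summable fun s : ℤ × ℤ =>
          A s * cexp (2 * Real.pi * I * s.2 * y) * cexp (2 * Real.pi * I * s.1 * x) :=
        Summable.of_norm (by simpa [hn] using hsum)
      have h3 := h1 ⟨-y - x / 2, Real.sqrt 3 / 2 * x⟩
      rw [fseries] at h3
      simp only [hw, ← mul_assoc] at h3
      rw [tsum_mul_right, mul_eq_zero] at h3
      have h4 := h3.resolve_right (by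
        rw [← norm_eq_zero, norm_wave]; exact one_ne_zero)
      rw [h2.tsum_prod] at h4
      rw [← h4]
      refine tsum_congr fun m => ?_
      exact tsum_mul_right.symm
  refine eq_zero_of_fourier_eq_zero (c := fun n => A (s.1, n)) (hsum.prod_factor s.1)
    (fun y => step y s.1) s.2

/-- The chiral model at quasi-momentum `K κ`, in Fourier coordinates. -/
def IsSol (α κ : ℂ) (A B : ℤ × ℤ → ℂ) : Prop :=
  (∀ s, (mom s + κ) * A s = α * I * ∑ l : Fin 3, ω ^ (l : ℕ) * B (offset l - s)) ∧
    ∀ s, (-mom s + κ) * B s = α * I * ∑ l : Fin 3, ω ^ (l : ℕ) * A (offset l - s)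

lemma fseries_add_period (A : ℤ × ℤ → ℂ) {ε : ℝ} (hε : ε = 1 ∨ ε = -1) {γ : ℂ} (hγ : γ ∈ Λ)
    (z : ℂ) : fseries ε A (z + γ) = cexp (-(ε * I) * (pair γ K : ℂ)) * fseries ε A z := by
  rw [fseries, fseries, ← tsum_mul_left]
  refine tsum_congr fun s => ?_
  rw [wave_add_right]
  suffices h : wave (ε * mom s) γ = cexp (-(ε * I) * (pair γ K : ℂ)) by rw [h]; ring
  obtain ⟨m, n, rfl⟩ := hγ
  have hs3 : Real.sqrt 3 ^ 2 = 3 := Real.sq_sqrt (by norm_num)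
  have hK : (K.re : ℝ) = 4 * Real.pi / 3 ∧ K.im = 0 := by
    have : K = ((4 * Real.pi / 3 : ℝ) : ℂ) := by rw [K]; push_cast; ring
    rw [this, ofReal_re, ofReal_im]
    exact ⟨rfl, rfl⟩
  have e : (4 * Real.pi / 3 * pair (m * ω + n) (ε * mom s) : ℝ) =
      -(ε * pair (m * ω + n) K) + ε * ((s.1 * m - s.2 * n : ℤ) * (2 * Real.pi)) := by
    simp only [pair_eq, re_ofReal_mul, im_ofReal_mul, mom_re, mom_im, hK]
    simp [ω_re, ω_im]
    linear_combination (ε * Real.pi / 3 * m * (2 * s.1 - s.2)) * hs3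
  rw [wave, e]
  push_cast
  rw [mul_add, Complex.exp_add]
  have e2 : cexp (I * (ε * ((s.1 * m - s.2 * n) * (2 * Real.pi)))) = 1 := by
    rcases hε with rfl | rfl
    · rw [exp_eq_one_iff]
      exact ⟨s.1 * m - s.2 * n, by push_cast; ring⟩
    · rw [exp_eq_one_iff]
      exact ⟨-(s.1 * m - s.2 * n), by push_cast; ring⟩
  rw [e2, mul_one]
  congr 1
  ring

lemma exists_mem_kerSet_of_isSol {α κ : ℂ} {A B : ℤ × ℤ → ℂ} (hA : RapidDecay A)
    (hB : RapidDecay B) (h : IsSol α κ A B) (h0 : ∃ s, A s ≠ 0 ∨ B s ≠ 0) :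
    ∃ u ∈ kerSet UBM (fun z => UBM (-z)) α (4 * Real.pi / 3 * κ), u ≠ 0 := by
  have hc (ε : ℝ) {A : ℤ × ℤ → ℂ} (hA : RapidDecay A) : ContDiff ℝ (⊤ : ℕ∞) (fseries ε A) :=
    contDiff_infty.mpr fun n => contDiff_fseries ε n hA
  have key (ε : ℝ) {A B : ℤ × ℤ → ℂ} (hA : RapidDecay A) (hB : RapidDecay B)
      (h : ∀ s, (ε * mom s + κ) * A s = α * I * ∑ l : Fin 3, ω ^ (l : ℕ) * B (offset l - s))
      (z : ℂ) : Dbar (fseries ε A) z + 4 * Real.pi / 3 * κ * fseries ε A z +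
        α * UBM (ε * z) * fseries (-ε) B z = 0 := by
    rw [mul_assoc α, UBM_mul_fseries hB, Dbar_fseries hA, ← fseries_const_mul, ← fseries_const_mul]
    have e (s : ℤ × ℤ) : α * (-(4 * Real.pi / 3) * I * ∑ l : Fin 3, ω ^ (l : ℕ) * B (offset l - s)) =
        -(A s * (4 * Real.pi / 3 * (ε * mom s)) + 4 * Real.pi / 3 * κ * A s) := by
      linear_combination (4 * Real.pi / 3) * h s
    simp only [e]
    have d1 : RapidDecay fun s => A s * (4 * Real.pi / 3 * (ε * mom s)) := by
      refine hA.mul_of_le (4 * Real.pi / 3 * |ε|) fun s => ?_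
      have h0 := Real.pi_pos
      simp [abs_of_pos h0, mul_assoc]
      gcongr
      linarith
    have d2 : RapidDecay fun s => 4 * Real.pi / 3 * κ * A s := by
      have := hA.mul_of_le (f := fun _ => 4 * Real.pi / 3 * κ) ‖(4 * Real.pi / 3 * κ : ℂ)‖ fun s =>
        le_mul_of_one_le_right (norm_nonneg _) (by linarith [norm_nonneg (mom s)])
      simpa only [mul_comm] using this
    have e2 := fseries_const_mul (-1) (fun s => A s * (4 * Real.pi / 3 * (ε * mom s)) +
      4 * Real.pi / 3 * κ * A s) ε z
    simp only [neg_one_mul] at e2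
    rw [e2, fseries_add d1 d2]
    ring
  refine ⟨fun z => (fseries 1 A z, fseries (-1) B z), ⟨(hc 1 hA).prodMk (hc (-1) hB), ?_, ?_, ?_, ?_⟩,
    ?_⟩
  · intro z
    simpa using key 1 hA hB (by simpa using h.1) z
  · intro z
    simpa using key (-1) hB hA (by simpa using h.2) z
  · intro γ hγ z
    simpa using fseries_add_period A (Or.inl rfl) hγ z
  · intro γ hγ z
    simpa using fseries_add_period B (Or.inr rfl) hγ z
  · intro hu
    obtain ⟨s, hs⟩ := h0
    have h1 (z : ℂ) : fseries 1 A z = 0 := congrArg Prod.fst (congrFun hu z)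
    have h2 (z : ℂ) : fseries (-1) B z = 0 := congrArg Prod.snd (congrFun hu z)
    rcases hs with hs | hs
    · exact hs (eq_zero_of_fseries_eq_zero hA one_ne_zero h1 s)
    · exact hs (eq_zero_of_fseries_eq_zero hB (by norm_num) h2 s)

lemma norm_mom_le (l : Fin 3) (s : ℤ × ℤ) : ‖mom s‖ ≤ 1 + ‖mom (offset l - s)‖ := by
  have h : mom s = ω ^ (l : ℕ) - mom (offset l - s) := by rw [mom_offset_sub]; ring
  calc ‖mom s‖ ≤ ‖ω ^ (l : ℕ)‖ + ‖mom (offset l - s)‖ := by rw [h]; exact norm_sub_le _ _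
    _ = _ := by rw [norm_pow, norm_ω, one_pow]

lemma norm_hopping_le {α : ℂ} {f : Fin 3 → ℂ} {C : ℝ} (h : ∀ l, ‖f l‖ ≤ C) :
    ‖α * I * ∑ l : Fin 3, ω ^ (l : ℕ) * f l‖ ≤ ‖α‖ * (3 * C) := by
  rw [norm_mul, norm_mul, norm_I, mul_one]
  gcongr
  refine (norm_sum_le _ _).trans ?_
  refine (Finset.sum_le_sum (g := fun _ => C) fun l _ => ?_).trans (by simp)
  rw [norm_mul, norm_pow, norm_ω, one_pow, one_mul]
  exact h l

lemma decay_step {α κ : ℂ} {A B : ℤ × ℤ → ℂ} {n : ℕ} {C : ℝ}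
    (h : ∀ s, (mom s + κ) * A s = α * I * ∑ l : Fin 3, ω ^ (l : ℕ) * B (offset l - s))
    (hA : ∀ s, ‖A s‖ * (1 + ‖mom s‖) ^ n ≤ C) (hB : ∀ s, ‖B s‖ * (1 + ‖mom s‖) ^ n ≤ C)
    (s : ℤ × ℤ) :
    ‖A s‖ * (1 + ‖mom s‖) ^ (n + 1) ≤ (1 + ‖κ‖) * C + ‖α‖ * (3 * (2 ^ n * C)) := by
  have h1 : ‖A s‖ * ‖mom s‖ ≤ ‖κ‖ * ‖A s‖ +
      ‖α * I * ∑ l : Fin 3, ω ^ (l : ℕ) * B (offset l - s)‖ := by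
    rw [← h, ← norm_mul, ← norm_mul]
    have : A s * mom s = (mom s + κ) * A s - κ * A s := by ring
    rw [this]
    exact (norm_sub_le _ _).trans_eq (add_comm _ _)
  have h2 : ‖α * I * ∑ l : Fin 3, ω ^ (l : ℕ) * B (offset l - s)‖ * (1 + ‖mom s‖) ^ n ≤
      ‖α‖ * (3 * (2 ^ n * C)) := by
    have hp : 0 < (1 + ‖mom s‖) ^ n := by positivity
    rw [← le_div_iff₀ hp, mul_div_assoc, mul_div_assoc]
    refine norm_hopping_le fun l => ?_
    rw [le_div_iff₀ hp]
    have h3 : 1 + ‖mom s‖ ≤ 2 * (1 + ‖mom (offset l - s)‖) := by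
      linarith [norm_mom_le l s, norm_nonneg (mom (offset l - s))]
    calc ‖B (offset l - s)‖ * (1 + ‖mom s‖) ^ n
        ≤ ‖B (offset l - s)‖ * (2 * (1 + ‖mom (offset l - s)‖)) ^ n := by gcongr
      _ = 2 ^ n * (‖B (offset l - s)‖ * (1 + ‖mom (offset l - s)‖) ^ n) := by rw [mul_pow]; ring
      _ ≤ 2 ^ n * C := by gcongr; exact hB _
  calc ‖A s‖ * (1 + ‖mom s‖) ^ (n + 1)
      = ‖A s‖ * (1 + ‖mom s‖) ^ n + ‖A s‖ * ‖mom s‖ * (1 + ‖mom s‖) ^ n := by ring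
    _ ≤ ‖A s‖ * (1 + ‖mom s‖) ^ n + (‖κ‖ * ‖A s‖ +
        ‖α * I * ∑ l : Fin 3, ω ^ (l : ℕ) * B (offset l - s)‖) * (1 + ‖mom s‖) ^ n := by gcongr
    _ = (1 + ‖κ‖) * (‖A s‖ * (1 + ‖mom s‖) ^ n) +
        ‖α * I * ∑ l : Fin 3, ω ^ (l : ℕ) * B (offset l - s)‖ * (1 + ‖mom s‖) ^ n := by ring
    _ ≤ _ := by gcongr; exact hA s

lemma sum_hopping_neg (α : ℂ) (f : Fin 3 → ℂ) :
    (-α) * I * ∑ l : Fin 3, ω ^ (l : ℕ) * f l = -(α * I * ∑ l : Fin 3, ω ^ (l : ℕ) * f l) := by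
  ring

lemma IsSol.rapidDecay {α κ : ℂ} {A B : ℤ × ℤ → ℂ} (h : IsSol α κ A B) {C : ℝ}
    (hA : ∀ s, ‖A s‖ ≤ C) (hB : ∀ s, ‖B s‖ ≤ C) : RapidDecay A ∧ RapidDecay B := by
  have key (n : ℕ) : ∃ C : ℝ, (∀ s, ‖A s‖ * (1 + ‖mom s‖) ^ n ≤ C) ∧
      ∀ s, ‖B s‖ * (1 + ‖mom s‖) ^ n ≤ C := by
    induction n with
    | zero => exact ⟨C, by simpa using hA, by simpa using hB⟩
    | succ n ih =>
      obtain ⟨C, h1, h2⟩ := ih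
      refine ⟨(1 + ‖κ‖) * C + ‖α‖ * (3 * (2 ^ n * C)), decay_step h.1 h1 h2, ?_⟩
      have := decay_step (α := -α) (κ := -κ) (fun s => by
        rw [sum_hopping_neg, ← h.2 s]; ring) h2 h1
      simpa using this
  exact ⟨fun n => (key n).imp fun _ h => h.1, fun n => (key n).imp fun _ h => h.2⟩

/-- Multiplication of the momenta by `ω`, on indices. -/
def rot : ℤ × ℤ ≃ ℤ × ℤ where
  toFun s := (-s.2 - 1, s.1 - s.2 - 1)
  invFun s := (s.2 - s.1, -s.1 - 1)
  left_inv s := Prod.ext (by ring) (by ring)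
  right_inv s := Prod.ext (by ring) (by ring)

lemma rot_apply (s : ℤ × ℤ) : rot s = (-s.2 - 1, s.1 - s.2 - 1) := rfl

lemma mom_rot (s : ℤ × ℤ) : mom (rot s) = ω * mom s := by
  simp only [mom, ev, site, rot_apply]
  push_cast
  linear_combination (-(2 * s.1 - s.2 : ℂ)) * ω_sq

/-- A bounded nonzero solution, in the rotation sector that kills the total sum, of the scalar
equation to which the chiral model at zero quasi-momentum reduces. -/
structure IsProtected (lam : ℂ) (a : ℤ × ℤ → ℂ) : Prop where
  bounded : ∃ C : ℝ, ∀ s, ‖a s‖ ≤ C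
  ne_zero : ∃ s, a s ≠ 0
  eqn : ∀ s, mom s * a s = lam * ∑ l : Fin 3, ω ^ (l : ℕ) * a (offset l - s)
  rot : ∀ s, a (rot s) = ω ^ 2 * a s

namespace IsProtected

variable {lam : ℂ} {a : ℤ × ℤ → ℂ}

lemma isSol_zero (h : IsProtected lam a) : IsSol (-lam) 0 a fun s => I * a s := by
  refine ⟨fun s => ?_, fun s => ?_⟩
  · rw [add_zero, h.eqn, Finset.mul_sum, Finset.mul_sum]
    refine Finset.sum_congr rfl fun l _ => ?_
    linear_combination (lam * ω ^ (l : ℕ) * a (offset l - s)) * I_sq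
  · linear_combination (-I) * h.eqn s

lemma rapidDecay (h : IsProtected lam a) : RapidDecay a := by
  obtain ⟨C, hC⟩ := h.bounded
  exact (h.isSol_zero.rapidDecay hC (fun s => by simpa using hC s)).1

lemma tsum_eq_zero (h : IsProtected lam a) : ∑' s, a s = 0 := by
  have h1 : ∑' s, a s = ω ^ 2 * ∑' s, a s := by
    rw [← tsum_mul_left, ← Equiv.tsum_eq TBG.rot a]
    exact tsum_congr h.rot
  have h2 : (1 - ω ^ 2) * ∑' s, a s = 0 := by linear_combination h1
  refine (mul_eq_zero.mp h2).resolve_left fun h3 => ?_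
  have h4 := congrArg Complex.re h3
  rw [ω_sq] at h4
  simp [ω_re] at h4
  norm_num at h4

end IsProtected

lemma finite_norm_mom_le (R : ℝ) : {s | ‖mom s‖ ≤ R}.Finite := by
  have h := summable_one_div_mom.tendsto_cofinite_zero
  rcases lt_or_ge R 0 with hR | hR
  · convert Set.finite_empty
    ext s
    simpa using hR.trans_le (norm_nonneg _)
  have h2 := h.eventually (gt_mem_nhds (show (0 : ℝ) < ((1 + R) ^ 4)⁻¹ by positivity))
  rw [Filter.eventually_cofinite] at h2
  refine h2.subset fun s (hs : ‖mom s‖ ≤ R) => ?_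
  simp only [Set.mem_ofPred_eq, not_lt]
  gcongr

lemma exists_gap {κ : ℂ} (h : ∀ u, mom u + 1 + κ ≠ 0) :
    ∃ d > 0, ∀ s r, d ≤ ‖mom s + κ - mom r‖ := by
  suffices H : ∃ d > 0, ∀ u, d ≤ ‖mom u + 1 + κ‖ by
    obtain ⟨d, hd, H⟩ := H
    refine ⟨d, hd, fun s r => ?_⟩
    have := mom_add (s - r) r
    rw [sub_add_cancel] at this
    convert H (s - r) using 2
    rw [this]; ring
  have hf := finite_norm_mom_le (2 + ‖κ‖)
  obtain ⟨d, hd, H⟩ : ∃ d > 0, ∀ u ∈ {s | ‖mom s‖ ≤ 2 + ‖κ‖}, d ≤ ‖mom u + 1 + κ‖ := by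
    rcases Set.eq_empty_or_nonempty {s | ‖mom s‖ ≤ 2 + ‖κ‖} with he | hne
    · exact ⟨1, one_pos, by simp [he]⟩
    · obtain ⟨v, hv, hmin⟩ := hf.exists_minimalFor (fun u => ‖mom u + 1 + κ‖) _ hne
      refine ⟨‖mom v + 1 + κ‖, norm_pos_iff.mpr (h v), fun u hu => ?_⟩
      rcases le_total ‖mom v + 1 + κ‖ ‖mom u + 1 + κ‖ with h1 | h1
      · exact h1
      · exact hmin hu h1
  refine ⟨min d 1, by positivity, fun u => ?_⟩
  by_cases hu : ‖mom u‖ ≤ 2 + ‖κ‖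
  · exact (min_le_left _ _).trans (H u hu)
  · push Not at hu
    refine (min_le_right _ _).trans ?_
    have : ‖mom u‖ ≤ ‖mom u + 1 + κ‖ + (1 + ‖κ‖) := by
      calc ‖mom u‖ = ‖(mom u + 1 + κ) - (1 + κ)‖ := by congr 1; ring
        _ ≤ ‖mom u + 1 + κ‖ + ‖1 + κ‖ := norm_sub_le _ _
        _ ≤ _ := by gcongr; exact (norm_add_le _ _).trans (by simp)
    linarith

open Polynomial in
lemma eq_zero_of_moments_eq_zero {ι : Type*} {a x : ι → ℂ} {R : ℝ} (ha : Summable fun r => ‖a r‖)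
    (hx : ∀ r, ‖x r‖ ≤ R) (hinj : Function.Injective x) (hx0 : ∀ r, x r ≠ 0)
    (hfin : ∀ e > 0, {r | e ≤ ‖x r‖}.Finite) (h : ∀ m : ℕ, ∑' r, a r * x r ^ m = 0) (r₀ : ι) :
    a r₀ = 0 := by
  have hsP (P : ℂ[X]) : Summable fun r => a r * P.eval (x r) := by
    induction P using Polynomial.induction_on' with
    | add p q hp hq => simpa only [eval_add, mul_add] using hp.add hq
    | monomial n c =>
      refine Summable.of_norm_bounded (ha.mul_right (‖c‖ * R ^ n)) fun r => ?_
      simp only [eval_monomial, norm_mul, norm_pow]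
      gcongr
      exact hx r
  have hP (P : ℂ[X]) : ∑' r, a r * P.eval (x r) = 0 := by
    induction P using Polynomial.induction_on' with
    | add p q hp hq =>
      simp only [eval_add, mul_add]
      rw [(hsP p).tsum_add (hsP q), hp, hq, add_zero]
    | monomial n c =>
      have e (r : ι) : a r * (monomial n c).eval (x r) = c * (a r * x r ^ n) := by
        rw [eval_monomial]; ring
      simp only [e, tsum_mul_left, h, mul_zero]
  have hpos : 0 < ‖x r₀‖ := norm_pos_iff.mpr (hx0 r₀)
  classical
  set S := (hfin (‖x r₀‖ / 2) (by positivity)).toFinset.erase r₀ with hS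
  set Q : ℂ[X] := ∏ r ∈ S, (X - C (x r)) with hQ
  have hQr (r : ι) (hr : r ∈ S) : Q.eval (x r) = 0 := by
    rw [hQ, eval_prod]
    exact Finset.prod_eq_zero hr (by simp)
  have hQ0 : Q.eval (x r₀) ≠ 0 := by
    rw [hQ, eval_prod]
    refine Finset.prod_ne_zero_iff.mpr fun r hr => ?_
    rw [eval_sub, eval_X, eval_C, sub_ne_zero]
    exact fun e => (Finset.mem_erase.mp hr).1 (hinj e).symm
  have hQb (r : ι) : ‖Q.eval (x r)‖ ≤ (2 * R) ^ S.card := by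
    rw [hQ, eval_prod, norm_prod]
    rw [← Finset.prod_const]
    refine Finset.prod_le_prod (fun _ _ => norm_nonneg _) fun i _ => ?_
    rw [eval_sub, eval_X, eval_C]
    exact (norm_sub_le _ _).trans (by linarith [hx r, hx i])
  have hsm (r : ι) (h0 : r ≠ r₀) (hr : r ∉ S) : ‖x r‖ ≤ ‖x r₀‖ / 2 := by
    by_contra hc
    exact hr (Finset.mem_erase.mpr ⟨h0, by simpa using (not_le.mp hc).le⟩)
  have key (N : ℕ) : ‖a r₀ * Q.eval (x r₀)‖ ≤ (1 / 2) ^ N * ((2 * R) ^ S.card * ∑' r, ‖a r‖) := by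
    have h1 := hP (X ^ N * Q)
    have h2 := hsP (X ^ N * Q)
    rw [h2.tsum_eq_add_tsum_ite r₀] at h1
    have h3 : ‖a r₀ * (X ^ N * Q).eval (x r₀)‖ ≤
        (‖x r₀‖ / 2) ^ N * (2 * R) ^ S.card * ∑' r, ‖a r‖ := by
      rw [eq_neg_of_add_eq_zero_left h1, norm_neg]
      refine tsum_of_norm_bounded (ha.hasSum.mul_left _) fun r => ?_
      split_ifs with hr
      · rw [norm_zero]
        have := (norm_nonneg _).trans (hQb r₀)
        positivity
      · by_cases hrS : r ∈ S
        · rw [eval_mul, hQr r hrS]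
          have := (norm_nonneg _).trans (hQb r₀)
          simp only [mul_zero, norm_zero]
          positivity
        · rw [eval_mul, eval_pow, eval_X, norm_mul, norm_mul, norm_pow, mul_comm]
          gcongr
          · exact hsm r hr hrS
          · exact hQb r
    rw [eval_mul, eval_pow, eval_X, norm_mul, norm_mul, norm_pow] at h3
    rw [norm_mul]
    have hp : 0 < ‖x r₀‖ ^ N := by positivity
    refine le_of_mul_le_mul_left ?_ hp
    calc ‖x r₀‖ ^ N * (‖a r₀‖ * ‖Q.eval (x r₀)‖) = ‖a r₀‖ * (‖x r₀‖ ^ N * ‖Q.eval (x r₀)‖) := by ring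
      _ ≤ _ := h3
      _ = _ := by rw [div_pow, one_div, inv_pow]; ring
  have hlim := ((tendsto_pow_atTop_nhds_zero_of_lt_one (r := (1 / 2 : ℝ)) (by norm_num)
    (by norm_num)).mul_const ((2 * R) ^ S.card * ∑' r, ‖a r‖))
  rw [zero_mul] at hlim
  have h0 := ge_of_tendsto' hlim key
  have h1 : a r₀ * Q.eval (x r₀) = 0 := norm_le_zero_iff.mp h0
  exact (mul_eq_zero.mp h1).resolve_right hQ0

/-- The Cauchy-type transforms of a family indexed by the momenta. -/
def cauchyT (a : ℤ × ℤ → ℂ) (m : ℕ) (w : ℂ) : ℂ := ∑' r, a r * ((w - mom r)⁻¹) ^ m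

lemma norm_inv_pow_le {w : ℂ} {d : ℝ} (hd : 0 < d) (hw : d ≤ ‖w‖) (m : ℕ) :
    ‖w⁻¹ ^ m‖ ≤ d⁻¹ ^ m := by
  rw [norm_pow, norm_inv]
  gcongr

lemma summable_cauchyT {a : ℤ × ℤ → ℂ} (ha : Summable fun r => ‖a r‖) (m : ℕ) {w : ℂ} {d : ℝ}
    (hd : 0 < d) (hw : ∀ r, d ≤ ‖w - mom r‖) : Summable fun r => a r * ((w - mom r)⁻¹) ^ m :=
  Summable.of_norm_bounded (ha.mul_right (d⁻¹ ^ m)) fun r => by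
    rw [norm_mul]
    gcongr
    exact norm_inv_pow_le hd (hw r) m

lemma norm_cauchyT_le {a : ℤ × ℤ → ℂ} (ha : Summable fun r => ‖a r‖) (m : ℕ) {w : ℂ} {d : ℝ}
    (hd : 0 < d) (hw : ∀ r, d ≤ ‖w - mom r‖) : ‖cauchyT a m w‖ ≤ (∑' r, ‖a r‖) * d⁻¹ ^ m :=
  tsum_of_norm_bounded (ha.hasSum.mul_right _) fun r => by
    rw [norm_mul]
    gcongr
    exact norm_inv_pow_le hd (hw r) m

lemma IsProtected.cauchyT_eqn {lam : ℂ} {a : ℤ × ℤ → ℂ} (h : IsProtected lam a) (m : ℕ) {w : ℂ}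
    {d : ℝ} (hd : 0 < d) (hw : ∀ r, d ≤ ‖w - mom r‖) :
    w * cauchyT a (m + 1) w = cauchyT a m w +
      lam * (-1) ^ (m + 1) * ∑ l : Fin 3, ω ^ (l : ℕ) * cauchyT a (m + 1) (ω ^ (l : ℕ) - w) := by
  have ha := h.rapidDecay.summable_norm
  have hl (l : Fin 3) : HasSum (fun r => ω ^ (l : ℕ) * a (offset l - r) * ((w - mom r)⁻¹) ^ (m + 1))
      ((-1) ^ (m + 1) * (ω ^ (l : ℕ) * cauchyT a (m + 1) (ω ^ (l : ℕ) - w))) := by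
    have hw' (r : ℤ × ℤ) : d ≤ ‖(ω ^ (l : ℕ) - w) - mom r‖ := by
      have := hw (offset l - r)
      rw [mom_offset_sub] at this
      rw [← norm_neg]
      exact this.trans_eq (congrArg _ (by ring))
    have h1 := ((summable_cauchyT ha (m + 1) hd hw').hasSum.mul_left
      (ω ^ (l : ℕ))).mul_left ((-1) ^ (m + 1))
    rw [← (Equiv.subLeft (offset l)).hasSum_iff] at h1
    refine Eq.mp (congrArg (HasSum · _) (funext fun r => ?_)) h1
    simp only [Function.comp_apply, Equiv.subLeft_apply]
    rw [mom_offset_sub]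
    have e : ω ^ (l : ℕ) - w - (ω ^ (l : ℕ) - mom r) = -(w - mom r) := by ring
    rw [e, inv_neg, neg_pow]
    have e2 : (-1 : ℂ) ^ (m + 1) * (-1) ^ (m + 1) = 1 := by rw [← mul_pow]; simp
    linear_combination (ω ^ (l : ℕ) * a (offset l - r) * ((w - mom r)⁻¹) ^ (m + 1)) * e2
  have h2 := (hasSum_sum fun l (_ : l ∈ Finset.univ) => hl l).mul_left lam
  have h3 := (summable_cauchyT ha m hd hw).hasSum.add h2
  have h4 := (summable_cauchyT ha (m + 1) hd hw).hasSum.mul_left w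
  have e (r : ℤ × ℤ) : a r * ((w - mom r)⁻¹) ^ m + lam * ∑ l : Fin 3,
      ω ^ (l : ℕ) * a (offset l - r) * ((w - mom r)⁻¹) ^ (m + 1) =
      w * (a r * ((w - mom r)⁻¹) ^ (m + 1)) := by
    have hne : w - mom r ≠ 0 := norm_pos_iff.mp (hd.trans_le (hw r))
    rw [← Finset.sum_mul, ← mul_assoc lam, ← h.eqn, pow_succ]
    have : (w - mom r) * (w - mom r)⁻¹ = 1 := mul_inv_cancel₀ hne
    linear_combination (-(a r * ((w - mom r)⁻¹) ^ m)) * this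
  simp only [e] at h3
  have h5 := h4.unique h3
  rw [cauchyT, h5, ← Finset.mul_sum]
  simp only [cauchyT]
  ring

lemma IsProtected.exists_cauchyT_ne_zero {lam : ℂ} {a : ℤ × ℤ → ℂ} (h : IsProtected lam a) {w : ℂ}
    {d : ℝ} (hd : 0 < d) (hw : ∀ r, d ≤ ‖w - mom r‖) : ∃ m, cauchyT a m w ≠ 0 := by
  by_contra! hc
  obtain ⟨r, hr⟩ := h.ne_zero
  refine hr (eq_zero_of_moments_eq_zero (x := fun r => (w - mom r)⁻¹) (R := d⁻¹)
    h.rapidDecay.summable_norm (fun r => ?_) (fun r s hrs => ?_) (fun r => ?_) (fun e he => ?_) hc r)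
  · simpa using norm_inv_pow_le hd (hw r) 1
  · exact mom_injective (sub_right_injective (inv_injective hrs))
  · exact inv_ne_zero (norm_pos_iff.mp (hd.trans_le (hw r)))
  · refine (finite_norm_mom_le (‖w‖ + e⁻¹)).subset fun r (hr : e ≤ ‖(w - mom r)⁻¹‖) => ?_
    rw [norm_inv] at hr
    have h1 : ‖w - mom r‖ ≤ e⁻¹ := by
      rw [← inv_inv ‖w - mom r‖]; exact inv_anti₀ he hr
    have h2 : ‖mom r‖ ≤ ‖w‖ + ‖w - mom r‖ := by
      have := norm_sub_le w (w - mom r)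
      rwa [sub_sub_cancel] at this
    exact h2.trans (by gcongr)

lemma mom_neg (u : ℤ × ℤ) : mom (-u) + 1 = -(mom u + 1) := by
  simp [mom, ev, site]; ring

lemma IsProtected.exists_isSol {lam : ℂ} {a : ℤ × ℤ → ℂ} (h : IsProtected lam a) (κ : ℂ) :
    ∃ A B, IsSol (-lam) κ A B ∧ (∃ C : ℝ, (∀ s, ‖A s‖ ≤ C) ∧ ∀ s, ‖B s‖ ≤ C) ∧
      ∃ s, A s ≠ 0 ∨ B s ≠ 0 := by
  by_cases hκ : ∀ u, mom u + 1 + κ ≠ 0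
  · obtain ⟨d, hd, hgap⟩ := exists_gap hκ
    have hgap' (s r : ℤ × ℤ) : d ≤ ‖mom s - κ - mom r‖ := by
      rw [← norm_neg]
      exact (hgap r s).trans_eq (congrArg _ (by ring))
    have ha := h.rapidDecay.summable_norm
    have hex : ∃ m, ∃ s, cauchyT a m (mom s + κ) ≠ 0 ∨ cauchyT a m (mom s - κ) ≠ 0 := by
      obtain ⟨m, hm⟩ := h.exists_cauchyT_ne_zero hd (hgap 0)
      exact ⟨m, 0, Or.inl hm⟩
    classical
    obtain ⟨m, hm, hmin⟩ := Nat.findX hex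
    rcases m with _ | m
    · simp [cauchyT, h.tsum_eq_zero] at hm
    have hz := hmin m m.lt_succ_self
    push Not at hz
    have hsq : (-1 : ℂ) ^ (m + 1) * (-1) ^ (m + 1) = 1 := by rw [← mul_pow]; simp
    refine ⟨fun s => cauchyT a (m + 1) (mom s + κ),
      fun s => I * (-1) ^ (m + 1) * cauchyT a (m + 1) (mom s - κ), ⟨fun s => ?_, fun s => ?_⟩,
      ⟨(∑' r, ‖a r‖) * d⁻¹ ^ (m + 1), fun s => norm_cauchyT_le ha _ hd (hgap s), fun s => ?_⟩, ?_⟩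
    · rw [h.cauchyT_eqn m hd (hgap s), (hz s).1, zero_add, Finset.mul_sum, Finset.mul_sum]
      refine Finset.sum_congr rfl fun l _ => ?_
      simp only [mom_offset_sub, ← sub_sub]
      linear_combination (lam * (-1) ^ (m + 1) * (ω ^ (l : ℕ) *
        cauchyT a (m + 1) (ω ^ (l : ℕ) - mom s - κ))) * I_sq
    · have h1 := h.cauchyT_eqn m hd (hgap' s)
      rw [(hz s).2, zero_add] at h1
      have e (l : Fin 3) : mom (offset l - s) + κ = ω ^ (l : ℕ) - (mom s - κ) := by
        rw [mom_offset_sub]; ring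
      simp only [e]
      linear_combination (-I * (-1) ^ (m + 1)) * h1 - (lam * I * ∑ l : Fin 3,
        ω ^ (l : ℕ) * cauchyT a (m + 1) (ω ^ (l : ℕ) - (mom s - κ))) * hsq
    · rw [norm_mul, norm_mul, norm_I, norm_pow, norm_neg, norm_one, one_pow, one_mul, one_mul]
      exact norm_cauchyT_le ha _ hd (hgap' s)
    · obtain ⟨s, hs⟩ := hm
      refine ⟨s, hs.imp id fun h1 => ?_⟩
      exact mul_ne_zero (mul_ne_zero I_ne_zero (pow_ne_zero _ (by norm_num))) h1
  · push Not at hκ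
    obtain ⟨u, hu⟩ := hκ
    obtain ⟨C, hC⟩ := h.bounded
    have hk : κ = mom (-u) + 1 := by rw [mom_neg]; linear_combination hu
    have hk' : κ = -(mom u + 1) := by rw [hk, mom_neg]
    refine ⟨fun s => a (s + -u), fun s => I * a (s + u), ⟨fun s => ?_, fun s => ?_⟩,
      ⟨C, fun s => hC _, fun s => by simpa using hC _⟩, ?_⟩
    · rw [hk, ← mom_add, h.eqn, Finset.mul_sum, Finset.mul_sum]
      refine Finset.sum_congr rfl fun l _ => ?_
      have e : offset l - (s + -u) = offset l - s + u := by abel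
      rw [e]
      linear_combination (lam * ω ^ (l : ℕ) * a (offset l - s + u)) * I_sq
    · have e (l : Fin 3) : offset l - s + -u = offset l - (s + u) := by abel
      have h1 := h.eqn (s + u)
      rw [mom_add] at h1
      simp only [e]
      rw [hk']
      linear_combination (-I) * h1
    · obtain ⟨s, hs⟩ := h.ne_zero
      exact ⟨s + u, Or.inl (by simpa using hs)⟩

lemma IsProtected.isMagic {lam : ℂ} {a : ℤ × ℤ → ℂ} (h : IsProtected lam a) :
    IsMagic UBM (fun z => UBM (-z)) (-lam) := by
  intro k
  obtain ⟨A, B, hs, ⟨C, hA, hB⟩, h0⟩ := h.exists_isSol (k / (4 * Real.pi / 3))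
  obtain ⟨dA, dB⟩ := hs.rapidDecay hA hB
  have := exists_mem_kerSet_of_isSol dA dB hs h0
  rwa [mul_div_cancel₀] at this
  simp [Real.pi_ne_zero]

/-- The Eisenstein integers. -/
abbrev Eis := QuadraticAlgebra ℤ (-1) (-1)

/-- The embedding of the Eisenstein integers in `ℂ`. -/
def eis : Eis →+* ℂ where
  toFun x := x.re + x.im * ω
  map_one' := by simp [QuadraticAlgebra.re_one, QuadraticAlgebra.im_one]
  map_zero' := by simp
  map_add' x y := by simp; ring
  map_mul' x y := by simp; linear_combination (-(x.im * y.im : ℂ)) * ω_sq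

lemma eis_apply (x : Eis) : eis x = x.re + x.im * ω := rfl

lemma eis_eq_ev (x : Eis) : eis x = ev (x.re, x.im) := rfl

lemma eis_omega : eis ⟨0, 1⟩ = ω := by simp [eis_apply]

/-- The hexagonal norm, a majorant of the absolute value. -/
def hexNorm (x : Eis) : ℕ := max x.re.natAbs (max x.im.natAbs (x.re - x.im).natAbs)

lemma norm_eis_le (x : Eis) : ‖eis x‖ ≤ hexNorm x := by
  refine le_of_sq_le_sq ?_ (Nat.cast_nonneg _)
  rw [eis_eq_ev, norm_ev_sq, enorm2]
  have h1 : (hexNorm x : ℤ) = max |x.re| (max |x.im| |x.re - x.im|) := by simp [hexNorm]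
  have h2 : x.re ^ 2 - x.re * x.im + x.im ^ 2 ≤ (hexNorm x : ℤ) ^ 2 := by
    have a1 : |x.re| ≤ hexNorm x := by rw [h1]; simp
    have a2 : |x.im| ≤ hexNorm x := by rw [h1]; simp
    have a3 : |x.re - x.im| ≤ hexNorm x := by rw [h1]; simp
    rw [abs_le] at a1 a2 a3
    clear h1
    generalize (hexNorm x : ℤ) = m at *
    have hm : 0 ≤ m := by linarith
    rcases le_total 0 x.re with hx | hx <;> rcases le_total 0 x.im with hy | hy <;>
      rcases le_total x.re x.im with hxy | hxy <;> nlinarith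
  exact_mod_cast h2

/-- The momenta of the first component, as Eisenstein integers. -/
def emom (s : ℤ × ℤ) : Eis := ⟨(site s).1, (site s).2⟩

lemma eis_emom (s : ℤ × ℤ) : eis (emom s) = mom s := rfl

/-- Families in the rotation sector of `ω²`. -/
def IsSym (a : ℤ × ℤ → ℂ) : Prop := ∀ s, a (rot s) = ω ^ 2 * a s

/-- The hopping operator. -/
def hop (a : ℤ × ℤ → ℂ) (s : ℤ × ℤ) : ℂ := ∑ l : Fin 3, ω ^ (l : ℕ) * a (offset l - s)

lemma hop_add (a b : ℤ × ℤ → ℂ) (s : ℤ × ℤ) : hop (fun s => a s + b s) s = hop a s + hop b s := by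
  simp [hop, mul_add, Finset.sum_add_distrib]

lemma hop_sub (a b : ℤ × ℤ → ℂ) (s : ℤ × ℤ) : hop (fun s => a s - b s) s = hop a s - hop b s := by
  simp [hop, mul_sub, Finset.sum_sub_distrib]

lemma norm_hop_le {a : ℤ × ℤ → ℂ} {C : ℝ} (h : ∀ s, ‖a s‖ ≤ C) (s : ℤ × ℤ) : ‖hop a s‖ ≤ 3 * C := by
  refine (norm_sum_le _ _).trans ((Finset.sum_le_sum (g := fun _ => C) fun l _ => ?_).trans (by simp))
  rw [norm_mul, norm_pow, norm_ω, one_pow, one_mul]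
  exact h _

lemma rot_rot_rot (s : ℤ × ℤ) : rot (rot (rot s)) = s := by
  simp only [rot_apply]
  exact Prod.ext (by ring) (by ring)

lemma enorm2_site_rot (s : ℤ × ℤ) : enorm2 (site (rot s)) = enorm2 (site s) := by
  simp only [enorm2, site, rot_apply]; ring

lemma IsSym.hop_rot {a : ℤ × ℤ → ℂ} (h : IsSym a) (s : ℤ × ℤ) : hop a (rot s) = hop a s := by
  have e0 : offset 0 - rot s = rot (offset 2 - s) := by
    simp [offset, rot_apply, Prod.ext_iff]; omega
  have e1 : offset 1 - rot s = rot (offset 0 - s) := by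
    simp [offset, rot_apply, Prod.ext_iff]; omega
  have e2 : offset 2 - rot s = rot (offset 1 - s) := by
    simp [offset, rot_apply, Prod.ext_iff]; omega
  simp only [hop, Fin.sum_univ_three, e0, e1, e2, h _]
  simp
  linear_combination (a (offset 0 - s) + a (offset 1 - s) * ω) * ω_cube

/-- The symmetric family with value `1` at `r`, supported on the orbit of `r`. -/
def chi (r s : ℤ × ℤ) : Eis :=
  (if s = r then 1 else 0) + (if s = rot r then ⟨-1, -1⟩ else 0) +
    if s = rot (rot r) then ⟨0, 1⟩ else 0

lemma chi_rot (r s : ℤ × ℤ) : chi r (rot s) = ⟨-1, -1⟩ * chi r s := by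
  have h1 : rot s = r ↔ s = rot (rot r) := by
    rw [← rot.injective.eq_iff, ← rot.injective.eq_iff, rot_rot_rot]
  have h2 : rot s = rot (rot r) ↔ s = rot r := rot.injective.eq_iff
  simp only [chi, h1, h2, rot.injective.eq_iff]
  split_ifs <;> ext <;> simp [QuadraticAlgebra.re_one, QuadraticAlgebra.im_one]

lemma eis_omega_sq : eis ⟨-1, -1⟩ = ω ^ 2 := by rw [ω_sq, eis_apply]; push_cast; ring

lemma chi_eq_zero {r s : ℤ × ℤ} (h0 : s ≠ r) (h1 : s ≠ rot r) (h2 : s ≠ rot (rot r)) :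
    chi r s = 0 := by
  simp [chi, h0, h1, h2]

/-- A general contraction principle for the topology of pointwise convergence. -/
lemma exists_fixed_point {ι : Type*} {S : Set (ι → ℂ)} {T : (ι → ℂ) → ι → ℂ} {ρ κ : ℝ}
    (hκ0 : 0 ≤ κ) (hκ : κ < 1) (hT : ∀ h ∈ S, T h ∈ S) (h0 : (0 : ι → ℂ) ∈ S)
    (hb : ∀ h ∈ S, ∀ s, ‖h s‖ ≤ ρ)
    (hc : ∀ (u : ℕ → ι → ℂ) (h : ι → ℂ), (∀ n, u n ∈ S) →
      (∀ s, Filter.Tendsto (fun n => u n s) Filter.atTop (nhds (h s))) → h ∈ S)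
    (hL : ∀ h ∈ S, ∀ g ∈ S, ∀ e : ℝ, (∀ s, ‖h s - g s‖ ≤ e) → ∀ s, ‖T h s - T g s‖ ≤ κ * e) :
    ∃ h ∈ S, T h = h := by
  set u : ℕ → ι → ℂ := fun n => T^[n] 0 with hu
  have husucc (n : ℕ) : u (n + 1) = T (u n) := Function.iterate_succ_apply' T n 0
  have huS (n : ℕ) : u n ∈ S := by
    induction n with
    | zero => exact h0
    | succ n ih => rw [husucc]; exact hT _ ih
  have hstep (n : ℕ) : ∀ s, ‖u (n + 1) s - u n s‖ ≤ ρ * κ ^ n := by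
    induction n with
    | zero => intro s; simpa [hu] using hb _ (huS 1) s
    | succ n ih =>
      intro s
      rw [husucc, husucc n]
      refine (hL _ (hT _ (huS n)) _ (huS n) (ρ * κ ^ n) (fun s => ?_) s).trans_eq (by ring)
      rw [← husucc]; exact ih s
  have hd (s : ι) (n : ℕ) : dist (u n s) (u (n + 1) s) ≤ ρ * κ ^ n := by
    rw [dist_comm, dist_eq_norm]; exact hstep n s
  have hlim (s : ι) : ∃ x, Filter.Tendsto (fun n => u n s) Filter.atTop (nhds x) :=
    cauchySeq_tendsto_of_complete (cauchySeq_of_le_geometric κ ρ hκ (hd s))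
  choose h hh using hlim
  have hS := hc u h huS hh
  refine ⟨h, hS, funext fun s => ?_⟩
  have hr (n : ℕ) (s : ι) : ‖u n s - h s‖ ≤ ρ * κ ^ n / (1 - κ) := by
    rw [← dist_eq_norm]
    exact dist_le_of_le_geometric_of_tendsto κ ρ hκ (hd s) (hh s) n
  have h1 : Filter.Tendsto (fun n => u (n + 1) s) Filter.atTop (nhds (T h s)) := by
    rw [tendsto_iff_norm_sub_tendsto_zero]
    refine squeeze_zero (fun n => norm_nonneg _) (fun n => ?_)
      (g := fun n => κ * (ρ * κ ^ n / (1 - κ))) ?_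
    · rw [husucc]
      exact hL _ (huS n) _ hS _ (hr n) s
    · have := tendsto_pow_atTop_nhds_zero_of_lt_one hκ0 hκ
      simpa using ((this.const_mul ρ).div_const (1 - κ)).const_mul κ
  exact tendsto_nhds_unique h1 ((Filter.tendsto_add_atTop_iff_nat 1).mpr (hh s))

/-- The approximate solution, on orbit representatives and scaled by `10000`. -/
def centerTable : List ((ℤ × ℤ) × Eis) :=
  [((0, 0), ⟨10000, 0⟩), ((-1, -2), ⟨1941, -5994⟩), ((0, 1), ⟨-1808, -5805⟩),
   ((1, 1), ⟨-6269, -4311⟩), ((-1, 1), ⟨455, -1759⟩), ((-2, 0), ⟨1785, -588⟩),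
   ((1, 2), ⟨-891, 272⟩), ((0, 2), ⟨-752, -249⟩), ((2, 2), ⟨97, 850⟩),
   ((-2, 1), ⟨-284, -304⟩), ((-1, 2), ⟨-230, -107⟩), ((-3, 0), ⟨-143, -206⟩),
   ((1, 3), ⟨36, 87⟩), ((2, 3), ⟨89, 92⟩), ((0, 3), ⟨5, 40⟩), ((3, 3), ⟨57, 13⟩),
   ((-2, 2), ⟨-9, 13⟩), ((-3, 1), ⟨-13, 5⟩), ((-1, 3), ⟨2, 11⟩), ((2, 4), ⟨4, 0⟩),
   ((-4, 0), ⟨-7, 2⟩), ((1, 4), ⟨3, 1⟩), ((3, 4), ⟨2, -3⟩)]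

/-- The approximate solution, scaled by `10000`. -/
def centerI (s : ℤ × ℤ) : Eis := (centerTable.map fun e => e.2 * chi e.1 s).sum

/-- Representatives of the inner orbits, apart from that of the origin. -/
def rep : Fin 8 → ℤ × ℤ :=
  ![(-1, -2), (0, 1), (1, 1), (-1, 1), (-2, 0), (1, 2), (0, 2), (2, 2)]

/-- An approximate inverse of the linearisation on the inner orbits, scaled by `100`. -/
def precI : Fin 8 → Fin 8 → Eis :=
  ![![⟨-32, -60⟩, ⟨-9, -21⟩, ⟨-24, -11⟩, ⟨-7, 0⟩, ⟨-9, -5⟩, ⟨-2, 2⟩, ⟨-2, -1⟩, ⟨0, 2⟩],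
    ![⟨-58, 13⟩, ⟨-10, 67⟩, ⟨-13, 41⟩, ⟨5, 23⟩, ⟨24, 29⟩, ⟨4, 1⟩, ⟨7, 6⟩, ⟨9, 6⟩],
    ![⟨2, 67⟩, ⟨31, 39⟩, ⟨0, 56⟩, ⟨15, 27⟩, ⟨13, 4⟩, ⟨1, 5⟩, ⟨1, -2⟩, ⟨9, 1⟩],
    ![⟨-41, -12⟩, ⟨-16, 3⟩, ⟨-26, -7⟩, ⟨19, 47⟩, ⟨-2, 10⟩, ⟨7, 17⟩, ⟨-4, 0⟩, ⟨13, 3⟩],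
    ![⟨-49, -37⟩, ⟨-38, -9⟩, ⟨-26, -4⟩, ⟨-12, 6⟩, ⟨34, 46⟩, ⟨3, -8⟩, ⟨13, 11⟩, ⟨6, 10⟩],
    ![⟨31, 19⟩, ⟨15, 1⟩, ⟨10, 2⟩, ⟨12, -9⟩, ⟨-11, -7⟩, ⟨-4, 31⟩, ⟨-4, 1⟩, ⟨-6, -7⟩],
    ![⟨16, 18⟩, ⟨13, 10⟩, ⟨11, 5⟩, ⟨2, -2⟩, ⟨0, -14⟩, ⟨-5, -2⟩, ⟨8, 30⟩, ⟨-5, 5⟩],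
    ![⟨19, -6⟩, ⟨7, -6⟩, ⟨6, -6⟩, ⟨-12, -16⟩, ⟨-7, -8⟩, ⟨-4, -4⟩, ⟨11, 3⟩, ⟨-23, 18⟩]]

/-- The indices treated by the explicit fixed point equation. -/
def IsOuter (s : ℤ × ℤ) : Prop := 25 ≤ enorm2 (site s)

instance : DecidablePred IsOuter := fun s => inferInstanceAs (Decidable (25 ≤ enorm2 (site s)))

/-- The hopping operator over the Eisenstein integers. -/
def hopI (a : ℤ × ℤ → Eis) (s : ℤ × ℤ) : Eis :=
  ∑ l : Fin 3, ⟨0, 1⟩ ^ (l : ℕ) * a (offset l - s)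

/-- The residual of the approximate solution, scaled by `10000 ^ 2`. -/
def residI (s : ℤ × ℤ) : Eis :=
  emom s * (⟨10000, 0⟩ - centerI (rep 0)) * centerI s - ⟨10000, 0⟩ * hopI centerI s

/-- The linearisation at the approximate solution on the inner orbits, scaled by `10000`. -/
def linI (l j : Fin 8) : Eis :=
  (if l = j then emom (rep l) * (⟨10000, 0⟩ - centerI (rep 0)) else 0) -
    (if j = 0 then emom (rep l) * centerI (rep l) else 0) - ⟨10000, 0⟩ * hopI (chi (rep j)) (rep l)

/-- The defect of the approximate inverse, scaled by `100 * 10000`. -/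
def defectI (i j : Fin 8) : Eis :=
  (if i = j then ⟨1000000, 0⟩ else 0) - ∑ l, precI i l * linI l j

/-- The number of outer neighbours of the inner representatives. -/
def numOuter (l : Fin 8) : ℕ := ∑ k : Fin 3, if IsOuter (offset k - rep l) then 1 else 0

/-- The box of indices with entries at most `n` in absolute value. -/
def box (n : ℕ) : Finset (ℤ × ℤ) := Finset.Icc (-n : ℤ) n ×ˢ Finset.Icc (-n : ℤ) n

lemma mem_box_of_mem_centerTable : ∀ e ∈ centerTable,
    e.1 ∈ box 5 ∧ rot e.1 ∈ box 5 ∧ rot (rot e.1) ∈ box 5 := by decide +kernel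

lemma hexNorm_centerI_le : ∀ s ∈ box 5, hexNorm (centerI s) ≤ 20000 ∧
    (IsOuter s → hexNorm (centerI s) ≤ 304) := by decide +kernel

lemma hexNorm_residI_le : ∀ s ∈ box 7, IsOuter s → hexNorm (residI s) ≤ 140000 := by decide +kernel

lemma chi_rep_rep : ∀ i j, chi (rep j) (rep i) = if i = j then 1 else 0 := by decide +kernel

lemma chi_rep_zero : ∀ j, chi (rep j) 0 = 0 := by decide +kernel

lemma sum_hexNorm_chi_le : ∀ s ∈ box 4, ∑ j, hexNorm (chi (rep j) s) ≤ 1 := by decide +kernel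

lemma mem_orbit_of_mem_box : ∀ s ∈ box 4, ¬ IsOuter s → (s = 0 ∨ s = rot 0 ∨ s = rot (rot 0)) ∨
    ∃ j, s = rep j ∨ s = rot (rep j) ∨ s = rot (rot (rep j)) := by decide +kernel

lemma not_isOuter_rep : ∀ j, ¬ IsOuter (rep j) := by decide +kernel

lemma hexNorm_sum_residI_le : ∀ i, hexNorm (∑ l, precI i l * residI (rep l)) ≤ 4000000 := by
  decide +kernel

lemma hexNorm_defectI_le : ∀ i, 1000 * ∑ j, hexNorm (defectI i j) +
    10000000 * ∑ l, hexNorm (precI i l) * numOuter l +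
    80000 * ∑ l, hexNorm (precI i l * emom (rep l)) ≤ 900000000 := by
  decide +kernel

lemma centerI_zero : centerI 0 = ⟨10000, 0⟩ := by decide +kernel

lemma centerI_rep_zero : centerI (rep 0) = ⟨1941, -5994⟩ := by decide +kernel

lemma isOuter_rot {s : ℤ × ℤ} : IsOuter (rot s) ↔ IsOuter s := by
  rw [IsOuter, IsOuter, enorm2_site_rot]

lemma IsOuter.le_norm_mom {s : ℤ × ℤ} (hs : IsOuter s) : 5 ≤ ‖mom s‖ := by
  refine le_of_sq_le_sq ?_ (norm_nonneg _)
  rw [mom, norm_ev_sq]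
  have : ((25 : ℤ) : ℝ) ≤ enorm2 (site s) := by exact_mod_cast hs
  norm_num at this ⊢
  exact this

lemma mem_box {n : ℕ} {s : ℤ × ℤ} : s ∈ box n ↔ (-n ≤ s.1 ∧ s.1 ≤ n) ∧ -n ≤ s.2 ∧ s.2 ≤ n := by
  simp [box]

lemma mem_box_of_not_isOuter {s : ℤ × ℤ} (hs : ¬ IsOuter s) : s ∈ box 4 := by
  have h : enorm2 (site s) < 25 := not_le.mp hs
  have h1 : 4 * enorm2 (site s) = (3 * s.2 + 2) ^ 2 + 3 * (2 * s.1 - s.2) ^ 2 := by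
    simp only [enorm2, site]; ring
  have h2 : (3 * s.2 + 2) ^ 2 < 10 ^ 2 := by nlinarith [sq_nonneg (2 * s.1 - s.2)]
  have h3 : (2 * s.1 - s.2) ^ 2 < 6 ^ 2 := by nlinarith [sq_nonneg (3 * s.2 + 2)]
  have h4 := abs_lt.mp (abs_lt_of_sq_lt_sq h2 (by norm_num))
  have h5 := abs_lt.mp (abs_lt_of_sq_lt_sq h3 (by norm_num))
  rw [mem_box]
  push_cast
  omega

lemma inner_induction {p : ℤ × ℤ → Prop} (hrot : ∀ s, p s → p (rot s)) (h0 : p 0)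
    (hrep : ∀ j, p (rep j)) {s : ℤ × ℤ} (hs : ¬ IsOuter s) : p s := by
  rcases mem_orbit_of_mem_box s (mem_box_of_not_isOuter hs) hs with (rfl | rfl | rfl) |
    ⟨j, rfl | rfl | rfl⟩
  exacts [h0, hrot _ h0, hrot _ (hrot _ h0), hrep j, hrot _ (hrep j), hrot _ (hrot _ (hrep j))]

lemma centerI_rot (s : ℤ × ℤ) : centerI (rot s) = ⟨-1, -1⟩ * centerI s := by
  rw [centerI, centerI, ← List.sum_map_mul_left]
  simp only [chi_rot, mul_left_comm]

lemma centerI_eq_zero {s : ℤ × ℤ} (hs : s ∉ box 5) : centerI s = 0 := by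
  rw [centerI]
  refine List.sum_eq_zero fun x hx => ?_
  obtain ⟨e, he, rfl⟩ := List.mem_map.mp hx
  obtain ⟨h0, h1, h2⟩ := mem_box_of_mem_centerTable e he
  rw [chi_eq_zero, mul_zero] <;> rintro rfl <;> contradiction

lemma residI_eq_zero {s : ℤ × ℤ} (hs : s ∉ box 7) : residI s = 0 := by
  have h1 : s ∉ box 5 := by
    rw [mem_box] at *; push_cast at *; omega
  have h2 (l : Fin 3) : offset l - s ∉ box 5 := by
    rw [mem_box] at *
    push_cast at *
    fin_cases l <;> simp [offset] at * <;> omega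
  simp [residI, hopI, centerI_eq_zero h1, centerI_eq_zero (h2 _)]

/-- The approximate solution. -/
def center (s : ℤ × ℤ) : ℂ := eis (centerI s) / 10000

lemma isSym_center : IsSym center := fun s => by
  rw [center, center, centerI_rot, map_mul, eis_omega_sq, mul_div_assoc]

lemma eis_ten_thousand : eis ⟨10000, 0⟩ = 10000 := by simp [eis_apply]

lemma center_zero : center 0 = 1 := by
  rw [center, centerI_zero, eis_ten_thousand]; norm_num

lemma norm_center_le (s : ℤ × ℤ) : ‖center s‖ ≤ 2 := by
  have h : hexNorm (centerI s) ≤ 20000 := by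
    by_cases hs : s ∈ box 5
    · exact (hexNorm_centerI_le s hs).1
    · rw [centerI_eq_zero hs]; decide
  have h' : (hexNorm (centerI s) : ℝ) ≤ 20000 := by exact_mod_cast h
  rw [center, norm_div]
  norm_num
  linarith [norm_eis_le (centerI s)]

lemma norm_center_le_of_isOuter {s : ℤ × ℤ} (ho : IsOuter s) : ‖center s‖ ≤ 304 / 10000 := by
  have h : hexNorm (centerI s) ≤ 304 := by
    by_cases hs : s ∈ box 5
    · exact (hexNorm_centerI_le s hs).2 ho
    · rw [centerI_eq_zero hs]; decide
  have h' : (hexNorm (centerI s) : ℝ) ≤ 304 := by exact_mod_cast h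
  rw [center, norm_div]
  norm_num
  linarith [norm_eis_le (centerI s)]

lemma hexNorm_residI_le_of_isOuter {s : ℤ × ℤ} (ho : IsOuter s) : hexNorm (residI s) ≤ 140000 := by
  by_cases hs : s ∈ box 7
  · exact hexNorm_residI_le s hs ho
  · rw [residI_eq_zero hs]; decide

lemma eis_hopI (a : ℤ × ℤ → Eis) (s : ℤ × ℤ) : eis (hopI a s) = hop (fun s => eis (a s)) s := by
  simp [hopI, hop, eis_omega]

lemma hop_center (s : ℤ × ℤ) : hop center s = eis (hopI centerI s) / 10000 := by
  simp only [eis_hopI, hop, center, Finset.sum_div, mul_div_assoc]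

/-- The inverse of the spectral parameter at the approximate solution. -/
def tc : ℂ := 1 - center (rep 0)

lemma center_rep_zero : center (rep 0) = (1941 - 5994 * ω) / 10000 := by
  rw [center, centerI_rep_zero, eis_apply]; push_cast; ring

lemma le_norm_tc : 71 / 100 ≤ ‖tc‖ := by
  refine le_of_sq_le_sq ?_ (norm_nonneg _)
  have h3 : Real.sqrt 3 ^ 2 = 3 := Real.sq_sqrt (by norm_num)
  rw [← normSq_eq_norm_sq, normSq_apply, tc, center_rep_zero]
  simp [ω_re, ω_im]
  nlinarith

lemma tc_ne_zero : tc ≠ 0 := norm_pos_iff.mp (by linarith [le_norm_tc])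

/-- The residual of the equation at a perturbation of the approximate solution. -/
def resid (h : ℤ × ℤ → ℂ) (s : ℤ × ℤ) : ℂ :=
  mom s * (tc - h (rep 0)) * (center s + h s) - (hop center s + hop h s)

lemma resid_zero (s : ℤ × ℤ) : resid 0 s = eis (residI s) / 100000000 := by
  have : hop 0 s = 0 := by simp [hop]
  rw [resid, this, hop_center, residI, tc, center, center, map_sub, map_mul, map_mul, map_mul,
    map_sub, eis_ten_thousand, eis_emom]
  simp
  ring

lemma resid_rot {h : ℤ × ℤ → ℂ} (hh : IsSym h) (s : ℤ × ℤ) : resid h (rot s) = resid h s := by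
  rw [resid, resid, mom_rot, isSym_center, hh s, hh.hop_rot, isSym_center.hop_rot]
  linear_combination (mom s * (tc - h (rep 0)) * (center s + h s)) * ω_cube

lemma resid_origin {h : ℤ × ℤ → ℂ} (hh : IsSym h) (h0 : h 0 = 0) : resid h 0 = 0 := by
  have e0 : offset 0 - 0 = rep 0 := rfl
  have e1 : offset 1 - 0 = rot (rot 0) := by decide
  have e2 : offset 2 - 0 = rot 0 := by decide
  have em : mom 0 = -1 := by simp [mom, ev, site]
  rw [resid, tc, hop, hop, Fin.sum_univ_three, Fin.sum_univ_three, e0, e1, e2, hh, hh,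
    isSym_center, isSym_center, h0, center_zero, em]
  simp
  linear_combination (-ω - ω ^ 2) * ω_cube - ω_sq

lemma resid_sub (h g : ℤ × ℤ → ℂ) (s : ℤ × ℤ) : resid h s - resid g s =
    mom s * tc * (h s - g s) - mom s * center s * (h (rep 0) - g (rep 0)) -
      hop (fun s => h s - g s) s -
      mom s * (h (rep 0) * (h s - g s) + (h (rep 0) - g (rep 0)) * g s) := by
  rw [hop_sub, resid, resid]; ring

lemma eis_chi_rot (r s : ℤ × ℤ) : eis (chi r (rot s)) = ω ^ 2 * eis (chi r s) := by
  rw [chi_rot, map_mul, eis_omega_sq]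

lemma sum_norm_chi_le {s : ℤ × ℤ} (hs : ¬ IsOuter s) : ∑ j, ‖eis (chi (rep j) s)‖ ≤ 1 := by
  refine (Finset.sum_le_sum fun j _ => norm_eis_le _).trans ?_
  exact_mod_cast sum_hexNorm_chi_le s (mem_box_of_not_isOuter hs)

lemma eis_chi_rep (i j : Fin 8) : eis (chi (rep j) (rep i)) = if i = j then 1 else 0 := by
  rw [chi_rep_rep]; split_ifs <;> simp

lemma chi_eq_zero_of_isOuter {s : ℤ × ℤ} (hs : IsOuter s) (j : Fin 8) : chi (rep j) s = 0 := by
  have h := not_isOuter_rep j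
  refine chi_eq_zero ?_ ?_ ?_ <;> rintro rfl
  · exact h hs
  · exact h (isOuter_rot.mp hs)
  · exact h (isOuter_rot.mp (isOuter_rot.mp hs))

lemma IsSym.eq_sum_chi {d : ℤ × ℤ → ℂ} (hd : IsSym d) (h0 : d 0 = 0) (s : ℤ × ℤ) :
    d s = ∑ j, eis (chi (rep j) s) * d (rep j) + if IsOuter s then d s else 0 := by
  split_ifs with hs
  · simp [chi_eq_zero_of_isOuter hs]
  · rw [add_zero]
    refine inner_induction (p := fun s => d s = ∑ j, eis (chi (rep j) s) * d (rep j))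
      (fun s ih => ?_) ?_ (fun i => ?_) hs
    · rw [hd, ih, Finset.mul_sum]
      exact Finset.sum_congr rfl fun j _ => by rw [eis_chi_rot]; ring
    · simp [chi_rep_zero, h0]
    · simp [eis_chi_rep]

/-- The outer part of the hopping operator. -/
def hopOut (d : ℤ × ℤ → ℂ) (s : ℤ × ℤ) : ℂ := hop (fun s => if IsOuter s then d s else 0) s

lemma norm_hopOut_le {d : ℤ × ℤ → ℂ} {e : ℝ} (hd : ∀ s, ‖d s‖ ≤ e) (l : Fin 8) :
    ‖hopOut d (rep l)‖ ≤ numOuter l * e := by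
  rw [hopOut, hop]
  refine (norm_sum_le _ _).trans ?_
  rw [numOuter]
  push_cast
  rw [Finset.sum_mul]
  refine Finset.sum_le_sum fun k _ => ?_
  rw [norm_mul, norm_pow, norm_ω, one_pow, one_mul]
  split_ifs
  · simpa using hd _
  · simp

lemma IsSym.hop_eq {d : ℤ × ℤ → ℂ} (hd : IsSym d) (h0 : d 0 = 0) (s : ℤ × ℤ) :
    hop d s = ∑ j, eis (hopI (chi (rep j)) s) * d (rep j) + hopOut d s := by
  have : d = fun s => ∑ j, eis (chi (rep j) s) * d (rep j) + if IsOuter s then d s else 0 :=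
    funext (hd.eq_sum_chi h0)
  conv_lhs => rw [this, hop_add]
  rw [hopOut]
  congr 1
  simp only [eis_hopI, hop, Finset.mul_sum, Finset.sum_mul]
  rw [Finset.sum_comm]
  simp only [mul_assoc]

lemma lin_eq {d : ℤ × ℤ → ℂ} (hd : IsSym d) (h0 : d 0 = 0) (l : Fin 8) :
    mom (rep l) * tc * d (rep l) - mom (rep l) * center (rep l) * d (rep 0) - hop d (rep l) =
      ∑ j, eis (linI l j) / 10000 * d (rep j) - hopOut d (rep l) := by
  have h (j : Fin 8) : eis (linI l j) / 10000 * d (rep j) =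
      (if l = j then mom (rep l) * tc * d (rep j) else 0) -
      (if j = 0 then mom (rep l) * center (rep l) * d (rep j) else 0) -
      eis (hopI (chi (rep j)) (rep l)) * d (rep j) := by
    rw [linI, map_sub, map_sub, map_mul, eis_ten_thousand, tc, center, center]
    split_ifs <;> simp [eis_emom, eis_ten_thousand] <;> ring
  simp only [h, Finset.sum_sub_distrib, Finset.sum_ite_eq, Finset.sum_ite_eq', Finset.mem_univ,
    if_true]
  rw [hd.hop_eq h0]
  ring

/-- The admissible perturbations. -/
def perturbations : Set (ℤ × ℤ → ℂ) := {h | IsSym h ∧ h 0 = 0 ∧ ∀ s, ‖h s‖ ≤ 1 / 250}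

/-- A quasi-Newton step for the inner orbits. -/
def row (h : ℤ × ℤ → ℂ) (i : Fin 8) : ℂ :=
  h (rep i) - ∑ l, eis (precI i l) / 100 * resid h (rep l)

/-- The map whose fixed points are the exact corrections. -/
def step (h : ℤ × ℤ → ℂ) (s : ℤ × ℤ) : ℂ :=
  if IsOuter s then (h (rep 0) * (center s + h s) + (hop center s + hop h s) / mom s) / tc - center s
  else ∑ j, eis (chi (rep j) s) * row h j

lemma row_sub {h g : ℤ × ℤ → ℂ} (hh : h ∈ perturbations) (hg : g ∈ perturbations) (i : Fin 8) :
    row h i - row g i = ∑ j, eis (defectI i j) / 1000000 * (h (rep j) - g (rep j)) +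
      ∑ l, eis (precI i l) / 100 * hopOut (fun s => h s - g s) (rep l) +
      ∑ l, eis (precI i l * emom (rep l)) / 100 * (h (rep 0) * (h (rep l) - g (rep l)) +
        (h (rep 0) - g (rep 0)) * g (rep l)) := by
  set d : ℤ × ℤ → ℂ := fun s => h s - g s with hd
  have hsym : IsSym d := fun s => by rw [hd]; simp only [hh.1 s, hg.1 s]; ring
  have h0 : d 0 = 0 := by simp [hd, hh.2.1, hg.2.1]
  have hr (l : Fin 8) : resid h (rep l) - resid g (rep l) =
      ∑ j, eis (linI l j) / 10000 * d (rep j) - hopOut d (rep l) -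
      mom (rep l) * (h (rep 0) * d (rep l) + d (rep 0) * g (rep l)) := by
    rw [resid_sub, ← lin_eq hsym h0]
  have hdef (j : Fin 8) : eis (defectI i j) / 1000000 * d (rep j) = (if i = j then d (rep j) else 0)
      - ∑ l, eis (precI i l) / 100 * (eis (linI l j) / 10000 * d (rep j)) := by
    rw [defectI, map_sub, map_sum, sub_div, sub_mul, Finset.sum_div, Finset.sum_mul]
    congr 1
    · split_ifs <;> simp [eis_apply]
    · refine Finset.sum_congr rfl fun l _ => ?_
      rw [map_mul]; ring
  have e : row h i - row g i = d (rep i) -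
      ∑ l, eis (precI i l) / 100 * (resid h (rep l) - resid g (rep l)) := by
    simp only [row, mul_sub, Finset.sum_sub_distrib, hd]; ring
  change row h i - row g i = ∑ j, eis (defectI i j) / 1000000 * d (rep j) +
    ∑ l, eis (precI i l) / 100 * hopOut d (rep l) + ∑ l, eis (precI i l * emom (rep l)) / 100 *
      (h (rep 0) * d (rep l) + d (rep 0) * g (rep l))
  simp only [hdef, Finset.sum_sub_distrib, Finset.sum_ite_eq, Finset.mem_univ, if_true]
  rw [Finset.sum_comm, e, ← sub_eq_zero]
  simp only [hr, ← Finset.mul_sum, map_mul, eis_emom]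
  have (l : Fin 8) : eis (precI i l) / 100 * (∑ j, eis (linI l j) / 10000 * d (rep j) -
      hopOut d (rep l) - mom (rep l) * (h (rep 0) * d (rep l) + d (rep 0) * g (rep l))) =
      eis (precI i l) / 100 * ∑ j, eis (linI l j) / 10000 * d (rep j) -
      eis (precI i l) / 100 * hopOut d (rep l) -
      eis (precI i l) * mom (rep l) / 100 * (h (rep 0) * d (rep l) + d (rep 0) * g (rep l)) := by
    ring
  simp only [this, Finset.sum_sub_distrib]
  ring

lemma norm_sum_mul_le {ι : Type*} [Fintype ι] {f g : ι → ℂ} {a b : ι → ℝ} (hf : ∀ i, ‖f i‖ ≤ a i)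
    (hg : ∀ i, ‖g i‖ ≤ b i) : ‖∑ i, f i * g i‖ ≤ ∑ i, a i * b i := by
  refine (norm_sum_le _ _).trans (Finset.sum_le_sum fun i _ => ?_)
  rw [norm_mul]
  exact mul_le_mul (hf i) (hg i) (norm_nonneg _) ((norm_nonneg _).trans (hf i))

lemma norm_eis_div_le (x : Eis) {n : ℕ} : ‖eis x / n‖ ≤ hexNorm x / n := by
  rw [norm_div, norm_natCast]
  gcongr
  exact norm_eis_le x

lemma norm_row_sub_le {h g : ℤ × ℤ → ℂ} (hh : h ∈ perturbations) (hg : g ∈ perturbations) {e : ℝ}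
    (he : ∀ s, ‖h s - g s‖ ≤ e) (i : Fin 8) : ‖row h i - row g i‖ ≤ 9 / 10 * e := by
  have he0 : 0 ≤ e := (norm_nonneg _).trans (he 0)
  have h1 := norm_sum_mul_le (fun j => norm_eis_div_le (defectI i j) (n := 1000000))
    (fun j => he (rep j))
  have h2 := norm_sum_mul_le (fun l => norm_eis_div_le (precI i l) (n := 100))
    (fun l => norm_hopOut_le he l)
  have h3 := norm_sum_mul_le (fun l => norm_eis_div_le (precI i l * emom (rep l)) (n := 100))
    (g := fun l => h (rep 0) * (h (rep l) - g (rep l)) + (h (rep 0) - g (rep 0)) * g (rep l))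
    (b := fun _ => 2 * (1 / 250) * e) (fun l => by
      have a1 := mul_le_mul (hh.2.2 (rep 0)) (he (rep l)) (norm_nonneg _) (by norm_num)
      have a2 := mul_le_mul (he (rep 0)) (hg.2.2 (rep l)) (norm_nonneg _) he0
      refine (norm_add_le _ _).trans ?_
      rw [norm_mul, norm_mul]
      linarith)
  have hk : (1000 * ∑ j, (hexNorm (defectI i j) : ℝ) +
      10000000 * ∑ l, (hexNorm (precI i l) : ℝ) * numOuter l +
      80000 * ∑ l, (hexNorm (precI i l * emom (rep l)) : ℝ)) ≤ 900000000 := by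
    exact_mod_cast hexNorm_defectI_le i
  have hk' := mul_le_mul_of_nonneg_right hk he0
  have e1 : ∑ j, (hexNorm (defectI i j) : ℝ) / (1000000 : ℕ) * e =
      (∑ j, (hexNorm (defectI i j) : ℝ)) * e / 1000000 := by
    rw [Finset.sum_mul, Finset.sum_div]
    exact Finset.sum_congr rfl fun _ _ => by push_cast; ring
  have e2 : ∑ l, (hexNorm (precI i l) : ℝ) / (100 : ℕ) * (numOuter l * e) =
      (∑ l, (hexNorm (precI i l) : ℝ) * numOuter l) * e / 100 := by
    rw [Finset.sum_mul, Finset.sum_div]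
    exact Finset.sum_congr rfl fun _ _ => by push_cast; ring
  have e3 : ∑ l, (hexNorm (precI i l * emom (rep l)) : ℝ) / (100 : ℕ) * (2 * (1 / 250) * e) =
      (∑ l, (hexNorm (precI i l * emom (rep l)) : ℝ)) * e / 12500 := by
    rw [Finset.sum_mul, Finset.sum_div]
    exact Finset.sum_congr rfl fun _ _ => by push_cast; ring
  rw [e1] at h1
  rw [e2] at h2
  rw [e3] at h3
  push_cast at h1 h2 h3
  rw [row_sub hh hg]
  refine (norm_add₃_le).trans ?_
  linarith

lemma norm_row_zero_le (i : Fin 8) : ‖row 0 i‖ ≤ 1 / 2500 := by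
  have h : row 0 i = -(eis (∑ l, precI i l * residI (rep l)) / (10000000000 : ℕ)) := by
    rw [row, map_sum, Finset.sum_div]
    simp only [resid_zero, Pi.zero_apply, zero_sub, map_mul]
    congr 1
    refine Finset.sum_congr rfl fun l _ => ?_
    push_cast; ring
  have h2 : (hexNorm (∑ l, precI i l * residI (rep l)) : ℝ) ≤ 4000000 := by
    exact_mod_cast hexNorm_sum_residI_le i
  rw [h, norm_neg]
  refine (norm_eis_div_le _).trans ?_
  push_cast
  linarith

lemma norm_step_sub_le {h g : ℤ × ℤ → ℂ} (hh : h ∈ perturbations) (hg : g ∈ perturbations) {e : ℝ}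
    (he : ∀ s, ‖h s - g s‖ ≤ e) (s : ℤ × ℤ) : ‖step h s - step g s‖ ≤ 9 / 10 * e := by
  have he0 : 0 ≤ e := (norm_nonneg _).trans (he 0)
  rw [step, step]
  split_ifs with hs
  · have h5 := hs.le_norm_mom
    have e1 : (h (rep 0) * (center s + h s) + (hop center s + hop h s) / mom s) / tc - center s -
        ((g (rep 0) * (center s + g s) + (hop center s + hop g s) / mom s) / tc - center s) =
        (center s * (h (rep 0) - g (rep 0)) + (h (rep 0) * (h s - g s) +
          (h (rep 0) - g (rep 0)) * g s) + hop (fun s => h s - g s) s / mom s) / tc := by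
      rw [hop_sub]; ring
    have a0 := mul_le_mul (norm_center_le_of_isOuter hs) (he (rep 0)) (norm_nonneg _) (by norm_num)
    have a1 := mul_le_mul (hh.2.2 (rep 0)) (he s) (norm_nonneg _) (by norm_num)
    have a2 := mul_le_mul (he (rep 0)) (hg.2.2 s) (norm_nonneg _) he0
    have a3 : ‖hop (fun s => h s - g s) s / mom s‖ ≤ 3 * e / 5 := by
      rw [norm_div]
      exact div_le_div₀ (by positivity) (norm_hop_le he s) (by norm_num) h5
    rw [e1, norm_div, div_le_iff₀ (norm_pos_iff.mpr tc_ne_zero)]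
    have a4 := norm_add₃_le (a := center s * (h (rep 0) - g (rep 0))) (b := h (rep 0) * (h s - g s) +
          (h (rep 0) - g (rep 0)) * g s) (c := hop (fun s => h s - g s) s / mom s)
    have a5 := norm_add_le (h (rep 0) * (h s - g s)) ((h (rep 0) - g (rep 0)) * g s)
    simp only [norm_mul] at a4 a5
    have a6 := mul_le_mul_of_nonneg_left le_norm_tc he0
    linarith
  · rw [← Finset.sum_sub_distrib]
    simp only [← mul_sub]
    refine (norm_sum_mul_le (fun _ => le_rfl) (norm_row_sub_le hh hg he)).trans ?_
    rw [← Finset.sum_mul]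
    exact (mul_le_mul_of_nonneg_right (sum_norm_chi_le hs) (by positivity)).trans_eq (one_mul _)

lemma norm_step_zero_le (s : ℤ × ℤ) : ‖step 0 s‖ ≤ 1 / 2500 := by
  rw [step]
  split_ifs with hs
  · have h5 := hs.le_norm_mom
    have hm : mom s ≠ 0 := norm_pos_iff.mp (by linarith)
    have ht := tc_ne_zero
    have hr := resid_zero s
    have e : ((0 : ℤ × ℤ → ℂ) (rep 0) * (center s + (0 : ℤ × ℤ → ℂ) s) + (hop center s + hop 0 s) /
        mom s) / tc - center s = -(eis (residI s) / (100000000 : ℕ)) / (mom s * tc) := by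
      push_cast
      rw [← hr, resid]
      simp
      field_simp
    rw [e, norm_div, norm_neg, norm_mul, div_le_iff₀ (by positivity)]
    refine (norm_eis_div_le _).trans ?_
    have h2 : (hexNorm (residI s) : ℝ) ≤ 140000 := by exact_mod_cast hexNorm_residI_le_of_isOuter hs
    have h3 := mul_le_mul h5 le_norm_tc (by norm_num) (norm_nonneg _)
    push_cast
    linarith
  · refine (norm_sum_mul_le (fun _ => le_rfl) norm_row_zero_le).trans ?_
    rw [← Finset.sum_mul]
    exact (mul_le_mul_of_nonneg_right (sum_norm_chi_le hs) (by positivity)).trans_eq (one_mul _)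

lemma zero_mem_perturbations : (0 : ℤ × ℤ → ℂ) ∈ perturbations :=
  ⟨fun s => by simp, rfl, fun s => by simp⟩

lemma step_mem {h : ℤ × ℤ → ℂ} (hh : h ∈ perturbations) : step h ∈ perturbations := by
  refine ⟨fun s => ?_, ?_, fun s => ?_⟩
  · simp only [step, isOuter_rot]
    split_ifs with hs
    · rw [hh.1, isSym_center, hh.1.hop_rot, isSym_center.hop_rot, mom_rot]
      have : ω⁻¹ = ω ^ 2 := inv_eq_of_mul_eq_one_right (by rw [← ω_cube]; ring)
      rw [div_mul_eq_div_div, div_eq_mul_inv _ ω, this]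
      ring
    · rw [Finset.mul_sum]
      exact Finset.sum_congr rfl fun j _ => by rw [eis_chi_rot]; ring
  · have : ¬ IsOuter 0 := by decide
    simp [step, this, chi_rep_zero]
  · have h1 := norm_step_sub_le hh zero_mem_perturbations (e := 1 / 250)
      (by simpa using hh.2.2) s
    have h2 := norm_step_zero_le s
    have h3 := norm_add_le (step h s - step 0 s) (step 0 s)
    rw [sub_add_cancel] at h3
    linarith

lemma exists_step_eq : ∃ h ∈ perturbations, step h = h := by
  refine exists_fixed_point (ρ := 1 / 250) (κ := 9 / 10) (by norm_num) (by norm_num)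
    (fun h => step_mem) zero_mem_perturbations (fun h hh => hh.2.2) (fun u h hu hlim => ?_)
    (fun h hh g hg e he => norm_step_sub_le hh hg he)
  refine ⟨fun s => ?_, ?_, fun s => ?_⟩
  · refine tendsto_nhds_unique (hlim (rot s)) ?_
    simpa only [(hu _).1 s] using (hlim s).const_mul (ω ^ 2)
  · refine tendsto_nhds_unique (hlim 0) ?_
    simp only [(hu _).2.1]
    exact tendsto_const_nhds
  · exact le_of_tendsto (hlim s).norm (Filter.Eventually.of_forall fun n => (hu n).2.2 s)

lemma det_precI_ne_zero : (Matrix.of fun i l => eis (precI i l) / 100).det ≠ 0 := by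
  set M : Matrix (Fin 8) (Fin 8) ℂ := Matrix.of fun l j => eis (linI l j) / 10000
  set P : Matrix (Fin 8) (Fin 8) ℂ := Matrix.of fun i l => eis (precI i l) / 100 with hP
  suffices h : (P * M).det ≠ 0 by
    rw [Matrix.det_mul] at h
    exact left_ne_zero_of_mul h
  have hPM (i j : Fin 8) : (P * M) i j = (if i = j then 1 else 0) - eis (defectI i j) / 1000000 := by
    rw [defectI, map_sub, map_sum, Matrix.mul_apply, sub_div, Finset.sum_div]
    have : eis (if i = j then ⟨1000000, 0⟩ else 0) / 1000000 = if i = j then 1 else 0 := by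
      split_ifs <;> simp [eis_apply]
    rw [this, sub_sub_cancel]
    refine Finset.sum_congr rfl fun l _ => ?_
    simp only [P, M, Matrix.of_apply, map_mul]
    ring
  refine det_ne_zero_of_sum_row_lt_diag fun i => ?_
  have h1 : ∑ j, ‖eis (defectI i j) / 1000000‖ < 1 := by
    have h2 : ∑ j, (hexNorm (defectI i j) : ℝ) ≤ 900000 := by
      have := hexNorm_defectI_le i
      exact_mod_cast (by omega : ∑ j, hexNorm (defectI i j) ≤ 900000)
    calc ∑ j, ‖eis (defectI i j) / 1000000‖ ≤ ∑ j, (hexNorm (defectI i j) : ℝ) / 1000000 :=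
          Finset.sum_le_sum fun j _ => by
            have := norm_eis_div_le (defectI i j) (n := 1000000)
            push_cast at this
            exact this
      _ = (∑ j, (hexNorm (defectI i j) : ℝ)) / 1000000 := by rw [Finset.sum_div]
      _ < 1 := by linarith
  rw [← Finset.add_sum_erase _ _ (Finset.mem_univ i)] at h1
  have h3 : ∑ j ∈ Finset.univ.erase i, ‖(P * M) i j‖ =
      ∑ j ∈ Finset.univ.erase i, ‖eis (defectI i j) / 1000000‖ := by
    refine Finset.sum_congr rfl fun j hj => ?_
    rw [hPM, if_neg (Finset.ne_of_mem_erase hj).symm, zero_sub, norm_neg]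
  rw [h3, hPM, if_pos rfl]
  have h4 := norm_sub_norm_le 1 (eis (defectI i i) / 1000000)
  rw [norm_one] at h4
  linarith

lemma resid_eq_zero {h : ℤ × ℤ → ℂ} (hh : h ∈ perturbations) (hfix : step h = h) (s : ℤ × ℤ) :
    resid h s = 0 := by
  by_cases hs : IsOuter s
  · have h5 := hs.le_norm_mom
    have hm : mom s ≠ 0 := norm_pos_iff.mp (by linarith)
    have ht := tc_ne_zero
    have h1 := congrFun hfix s
    rw [step, if_pos hs] at h1
    have h2 : (hop center s + hop h s) / mom s = (h s + center s) * tc -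
        h (rep 0) * (center s + h s) := by
      rw [sub_eq_iff_eq_add, div_eq_iff ht] at h1
      linear_combination h1
    rw [div_eq_iff hm] at h2
    rw [resid, h2]; ring
  · refine inner_induction (p := fun s => resid h s = 0) (fun s ih => ?_)
      (resid_origin hh.1 hh.2.1) ?_ hs
    · rw [resid_rot hh.1, ih]
    · refine congrFun (f := fun l => resid h (rep l)) (g := 0)
        (Matrix.eq_zero_of_mulVec_eq_zero det_precI_ne_zero (funext fun i => ?_))
      have h1 := congrFun hfix (rep i)
      rw [step, if_neg (not_isOuter_rep i)] at h1
      simp only [eis_chi_rep, ite_mul, one_mul, zero_mul, Finset.sum_ite_eq, Finset.mem_univ,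
        if_true, row] at h1
      simpa [Matrix.mulVec, dotProduct] using h1

lemma exists_isProtected : ∃ lam a, lam.im ≠ 0 ∧ IsProtected lam a := by
  obtain ⟨h, hh, hfix⟩ := exists_step_eq
  set t := tc - h (rep 0) with ht
  have him : t.im ≠ 0 := by
    have h1 := (abs_im_le_norm (h (rep 0))).trans (hh.2.2 (rep 0))
    have h2 : 1 < Real.sqrt 3 := Real.lt_sqrt_of_sq_lt (by norm_num)
    have h3 : tc.im = 5994 / 20000 * Real.sqrt 3 := by
      rw [tc, center_rep_zero]
      simp [ω_re, ω_im]
      ring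
    rw [ht, sub_im, h3]
    have := abs_le.mp h1
    intro h4
    linarith
  have ht0 : t ≠ 0 := fun h0 => him (by rw [h0, zero_im])
  refine ⟨t⁻¹, fun s => center s + h s, ?_, ⟨3, fun s => ?_⟩, ⟨0, ?_⟩, fun s => ?_, fun s => ?_⟩
  · rw [inv_im]
    exact div_ne_zero (neg_ne_zero.mpr him) (normSq_eq_zero.not.mpr ht0)
  · exact (norm_add_le _ _).trans (by linarith [norm_center_le s, hh.2.2 s])
  · simp [center_zero, hh.2.1]
  · have h1 := resid_eq_zero hh hfix s
    rw [resid, ← hop_add, ← ht, hop] at h1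
    rw [← sub_eq_zero.mp h1]
    field_simp
  · rw [isSym_center, hh.1, mul_add]

/-- **existence of a non-real magic parameter for the BM potential.** -/
theorem exists_nonreal_magic_BM :
    ∃ α : ℂ, α.im ≠ 0 ∧ IsMagic UBM (fun z => UBM (-z)) α := by
  obtain ⟨lam, a, him, ha⟩ := exists_isProtected
  exact ⟨-lam, by simpa using him, ha.isMagic⟩

end TBG
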